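/- arXiv:2110.15585 — 5 statements merged into one kernel-verified Lean document; each statement's English description precedes it below -/
import Mathlib

section
/- Let m ≥ 4 be an integer and let a be a nonzero element of the finite field F_{2^m}. If the Kloosterman sum K_{2^m}(a) is divisible by 16, then the absolute trace T_{2^m}(a) = 0 and the subtrace S_{2^m}(a) = 0. -/
/-- Absolute trace `T_{2^m}(a) = Σ_{0 ≤ i < m} a^(2^i)` (an element of `F_2 ⊆ F`). -/
def absTrace {F : Type*} [Field F] (m : ℕ) (a : F) : F :=
  ∑ i ∈ Finset.range m, a ^ (2 ^ i)

/-- Subtrace `S_{2^m}(a) = Σ_{0 ≤ i < j < m} a^(2^i + 2^j)` (an element of `F_2 ⊆ F`). -/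
def subTrace {F : Type*} [Field F] (m : ℕ) (a : F) : F :=
  ∑ i ∈ Finset.range m, ∑ j ∈ Finset.Ico (i + 1) m, a ^ (2 ^ i + 2 ^ j)

/-- `(-1)^u` for `u ∈ F_2 = {0, 1} ⊆ F`, as an integer. -/
def sgn {F : Type*} [Field F] [DecidableEq F] (u : F) : ℤ :=
  if u = 0 then 1 else -1

/-- The Kloosterman sum `K_{2^m}(a) = 1 + Σ_{x ∈ F^*} (-1)^{Tr^m_1(1/x + a x)}`. -/
def kloosterman {F : Type*} [Field F] [Fintype F] [DecidableEq F] (m : ℕ) (a : F) : ℤ :=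
  1 + ∑ x ∈ Finset.univ.filter (fun x : F => x ≠ 0), sgn (absTrace m (x⁻¹ + a * x))

theorem ktr_add {F : Type*} [Field F] [CharP F 2] (m : ℕ) (x y : F) :
    absTrace m (x + y) = absTrace m x + absTrace m y := by
  simp only [absTrace, add_pow_char_pow, Finset.sum_add_distrib]

theorem ktr_sq {F : Type*} [Field F] [CharP F 2] (m : ℕ) (x : F) (hx : x ^ 2 ^ m = x) :
    absTrace m (x ^ 2) = absTrace m x := by
  have h1 := Finset.sum_range_succ (fun i => x ^ 2 ^ i) m
  have h2 := Finset.sum_range_succ' (fun i => x ^ 2 ^ i) m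
  rw [h1, hx, pow_zero, pow_one] at h2
  have h3 := add_right_cancel h2
  simp only [absTrace]
  rw [h3]
  exact Finset.sum_congr rfl fun i _ => by rw [← pow_mul, pow_succ' 2 i]

theorem ktr_pow {F : Type*} [Field F] [CharP F 2] (m : ℕ) (x : F) :
    (absTrace m x) ^ 2 = absTrace m (x ^ 2) := by
  simp only [absTrace]
  rw [← frobenius_def, map_sum]
  exact Finset.sum_congr rfl fun i _ => by rw [frobenius_def, ← pow_mul, ← pow_mul, mul_comm]

theorem ktr_card {F : Type*} [Field F] [Fintype F] [DecidableEq F] (m : ℕ) (hm : 0 < m) :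
    (Finset.univ.filter fun x : F => absTrace m x = 0).card ≤ 2 ^ (m - 1) := by
  classical
  let p : Polynomial F := ∑ i ∈ Finset.range m, Polynomial.X ^ (2 ^ i)
  have hp : p ≠ 0 := by
    intro h
    have h1 : p.coeff 1 = 1 := by
      simp only [p, Polynomial.finsetSum_coeff, Polynomial.coeff_X_pow]
      rw [Finset.sum_eq_single 0]
      · simp
      · intro b _ hb
        rw [if_neg]
        intro h
        have : 1 < 2 ^ b := Nat.one_lt_two_pow hb
        omega
      · intro h
        simp at h
        omega
    rw [h] at h1
    simp at h1
  have hd : p.natDegree ≤ 2 ^ (m - 1) := by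
    apply Polynomial.natDegree_sum_le_of_forall_le
    intro i hi
    rw [Polynomial.natDegree_X_pow]
    have := Finset.mem_range.1 hi
    exact Nat.pow_le_pow_right (by norm_num) (by omega)
  have hsub : (Finset.univ.filter fun x : F => absTrace m x = 0) ⊆ p.roots.toFinset := by
    intro x hx
    rw [Multiset.mem_toFinset, Polynomial.mem_roots hp, Polynomial.IsRoot.def]
    simpa [p, Polynomial.eval_finsetSum, absTrace] using (Finset.mem_filter.1 hx).2
  calc _ ≤ p.roots.toFinset.card := Finset.card_le_card hsub
    _ ≤ Multiset.card p.roots := Multiset.toFinset_card_le _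
    _ ≤ _ := (Polynomial.card_roots' p).trans hd

theorem kas_fiber {F : Type*} [Field F] [CharP F 2] [Fintype F] [DecidableEq F] (t : F) :
    (Finset.univ.filter fun s : F => s ^ 2 + s = t ^ 2 + t) = {t, t + 1} := by
  have h2 : (2 : F) = 0 := CharTwo.two_eq_zero
  ext s
  simp only [Finset.mem_filter, Finset.mem_univ, true_and, Finset.mem_insert,
    Finset.mem_singleton]
  constructor
  · intro h
    have : (s - t) * (s - (t + 1)) = 0 := by
      linear_combination h + (t ^ 2 + t - s * t - s) * h2
    rcases mul_eq_zero.1 this with h | h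
    · left; exact sub_eq_zero.1 h
    · right; exact sub_eq_zero.1 h
  · rintro (rfl | rfl)
    · rfl
    · linear_combination (t + 1) * h2

theorem kas_card {F : Type*} [Field F] [CharP F 2] [Fintype F] [DecidableEq F] (m : ℕ)
    (hm : 0 < m) (hcard : Fintype.card F = 2 ^ m) (u : F) :
    ((Finset.univ.filter fun s : F => s ^ 2 + s = u).card : ℤ) = 1 + sgn (absTrace m u) := by
  have hfr : ∀ x : F, x ^ 2 ^ m = x := fun x => by rw [← hcard]; exact FiniteField.pow_card x
  have htr : ∀ s : F, absTrace m (s ^ 2 + s) = 0 := fun s => by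
    rw [ktr_add, ktr_sq m s (hfr s)]; exact CharTwo.add_self_eq_zero _
  have hfib : ∀ t : F, (Finset.univ.filter fun s : F => s ^ 2 + s = t ^ 2 + t).card = 2 := by
    intro t
    rw [kas_fiber, Finset.card_pair]
    simp
  have himg : (Finset.univ.image fun s : F => s ^ 2 + s) =
      Finset.univ.filter fun x : F => absTrace m x = 0 := by
    apply Finset.eq_of_subset_of_card_le
    · intro x hx
      obtain ⟨s, -, rfl⟩ := Finset.mem_image.1 hx
      simp [htr]
    · refine (ktr_card m hm).trans ?_
      have h := Finset.card_le_mul_card_image (f := fun s : F => s ^ 2 + s) Finset.univ 2 (by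
        intro a ha
        obtain ⟨s, -, rfl⟩ := Finset.mem_image.1 ha
        exact (hfib s).le)
      rw [Finset.card_univ, hcard] at h
      obtain ⟨k, rfl⟩ : ∃ k, m = k + 1 := ⟨m - 1, by omega⟩
      rw [pow_succ] at h
      simp only [Nat.add_sub_cancel]
      omega
  by_cases hu : absTrace m u = 0
  · have : u ∈ (Finset.univ.image fun s : F => s ^ 2 + s) := by rw [himg]; simp [hu]
    obtain ⟨s, -, rfl⟩ := Finset.mem_image.1 this
    simp only [hfib, sgn, hu]
    norm_num
  · have : (Finset.univ.filter fun s : F => s ^ 2 + s = u) = ∅ := by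
      apply Finset.filter_eq_empty_iff.2
      rintro s - rfl
      exact hu (htr s)
    rw [this]
    simp [sgn, hu]

/-- polarization of the subtrace -/
theorem kst_polar {F : Type*} [Field F] [CharP F 2] (m : ℕ) (x y : F) :
    subTrace m (x + y) = subTrace m x + subTrace m y
      + absTrace m x * absTrace m y + absTrace m (x * y) := by
  have h2 : (2 : F) = 0 := CharTwo.two_eq_zero
  have rec1 : ∀ (k : ℕ) (z : F), subTrace (k + 1) z = subTrace k z + absTrace k z * z ^ 2 ^ k := by
    intro k z
    simp only [subTrace, absTrace]
    rw [Finset.sum_range_succ, Finset.Ico_self, Finset.sum_empty, add_zero, Finset.sum_mul,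
      ← Finset.sum_add_distrib]
    refine Finset.sum_congr rfl fun i hi => ?_
    have := Finset.mem_range.1 hi
    rw [Finset.sum_Ico_succ_top (by omega), pow_add _ _ (2 ^ k)]
  have rec2 : ∀ (k : ℕ) (z : F), absTrace (k + 1) z = absTrace k z + z ^ 2 ^ k := by
    intro k z
    simp only [absTrace, Finset.sum_range_succ]
  induction m with
  | zero => simp [subTrace, absTrace]
  | succ k ih =>
    rw [rec1, rec1, rec1, rec2 k x, rec2 k y, rec2 k (x * y), ih, ktr_add, add_pow_char_pow,
      mul_pow]
    linear_combination (- x ^ 2 ^ k * y ^ 2 ^ k) * h2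

theorem kst_sq {F : Type*} [Field F] [CharP F 2] (m : ℕ) (x : F) (hx : x ^ 2 ^ m = x) :
    subTrace m (x ^ 2) = subTrace m x := by
  rcases m with _ | n
  · simp [subTrace]
  have e1 : subTrace (n + 1) x = (∑ i ∈ Finset.range n, ∑ j ∈ Finset.Ico (i + 1) n,
      (x ^ 2) ^ (2 ^ i + 2 ^ j)) + ∑ j ∈ Finset.range n, (x ^ 2) ^ 2 ^ j * x := by
    simp only [subTrace]
    rw [Finset.sum_range_succ']
    congr 1
    · refine Finset.sum_congr rfl fun i _ => ?_
      rw [← Finset.sum_Ico_add' _ (i + 1) n 1]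
      refine Finset.sum_congr rfl fun j _ => ?_
      rw [← pow_mul]; congr 1; ring
    · rw [Finset.range_eq_Ico, ← Finset.sum_Ico_add' _ 0 n 1]
      refine Finset.sum_congr rfl fun j _ => ?_
      rw [← pow_mul, ← pow_succ]; congr 1; ring
  rw [e1]
  simp only [subTrace]
  rw [Finset.sum_range_succ, Finset.Ico_self, Finset.sum_empty, add_zero,
      ← Finset.sum_add_distrib]
  refine Finset.sum_congr rfl fun i hi => ?_
  have := Finset.mem_range.1 hi
  rw [Finset.sum_Ico_succ_top (by omega), pow_add _ _ (2 ^ n)]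
  congr 2
  rw [← pow_mul, ← pow_succ', hx]

/-- the algebra at the end -/
theorem kfinal {F : Type*} [Field F] [CharP F 2] (m : ℕ)
    (hfr : ∀ x : F, x ^ 2 ^ m = x) (a c x : F) (hc0 : c ≠ 0) (hc : c ^ 4 = a)
    (hx : c * x ^ 2 = x ^ 4 + a) (htx : absTrace m x = 0) :
    absTrace m a = 0 ∧ subTrace m a = 0 := by
  have h2 : (2 : F) = 0 := CharTwo.two_eq_zero
  obtain ⟨z, hz⟩ : ∃ z : F, x ^ 2 = c * (c + z) := ⟨x ^ 2 / c - c, by field_simp; ring⟩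
  have hzc : z ^ 2 + z = c := by
    have : c ^ 2 * (z ^ 2 + z - c) = 0 := by
      have e : x ^ 4 = (c * (c + z)) ^ 2 := by rw [← hz]; ring
      rw [e, hz, ← hc] at hx
      linear_combination -hx + (c ^ 2 * z - c ^ 3 * z - c ^ 4) * h2
    rcases mul_eq_zero.1 this with h | h
    · exact absurd h (pow_ne_zero _ hc0)
    · exact sub_eq_zero.1 h
  have htc : absTrace m c = 0 := by
    rw [← hzc, ktr_add, ktr_sq m z (hfr z)]; exact CharTwo.add_self_eq_zero _
  have h1 : absTrace m (z ^ 3) + absTrace m z = 0 := by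
    have e : x ^ 2 = c ^ 2 + (z ^ 3 + z ^ 2) := by rw [hz, ← hzc]; ring
    have := ktr_sq m x (hfr x)
    rwa [e, ktr_add, ktr_add, ktr_sq m c (hfr c), ktr_sq m z (hfr z), htc, zero_add, htx] at this
  have hs : subTrace m c = 0 := by
    rw [← hzc, kst_polar, kst_sq m z (hfr z), ktr_sq m z (hfr z)]
    have e1 : absTrace m z * absTrace m z = absTrace m z := by
      rw [← pow_two, ktr_pow, ktr_sq m z (hfr z)]
    have e2 : z ^ 2 * z = z ^ 3 := by ring
    rw [e1, e2]
    linear_combination h1 + subTrace m z * h2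
  have e : a = (c ^ 2) ^ 2 := by rw [← hc]; ring
  rw [e, ktr_sq m _ (hfr _), ktr_sq m _ (hfr _), kst_sq m _ (hfr _), kst_sq m _ (hfr _)]
  exact ⟨htc, hs⟩

theorem kgroup {G : Type*} [CommGroup G] [Finite G] (z : G)
    (h : ∀ x : G, x ^ 2 = 1 → x = 1 ∨ x = z) (hd : 16 ∣ Nat.card G) :
    ∃ x : G, x ^ 16 = 1 ∧ x ^ 8 ≠ 1 := by
  classical
  have := Fintype.ofFinite G
  have hp : Fact (Nat.Prime 2) := ⟨Nat.prime_two⟩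
  obtain ⟨H, hH⟩ := Sylow.exists_subgroup_card_pow_prime (G := G) 2 (n := 4) (by simpa using hd)
  by_contra hcon
  push Not at hcon
  have step : ∀ k : ℕ, (Finset.univ.filter fun x : G => x ^ (2 ^ (k + 1)) = 1).card ≤
      2 * (Finset.univ.filter fun x : G => x ^ (2 ^ k) = 1).card := by
    intro k
    apply Finset.card_le_mul_card_image_of_maps_to (f := fun x : G => x ^ 2)
    · intro x hx
      have hx := (Finset.mem_filter.1 hx).2
      refine Finset.mem_filter.2 ⟨Finset.mem_univ _, ?_⟩
      rw [← pow_mul, ← pow_succ']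
      exact hx
    · intro b _
      rcases Finset.eq_empty_or_nonempty
        (Finset.filter (fun x : G => x ^ 2 = b) (Finset.univ.filter fun x : G =>
          x ^ (2 ^ (k + 1)) = 1)) with h0 | ⟨x0, hx0⟩
      · rw [h0]; simp
      · refine (Finset.card_le_card (t := {x0, z * x0}) ?_).trans Finset.card_le_two
        intro y hy
        have hx := (Finset.mem_filter.1 hx0).2
        have hy := (Finset.mem_filter.1 hy).2
        have : (y * x0⁻¹) ^ 2 = 1 := by rw [mul_pow, inv_pow, hx, hy, mul_inv_cancel]
        rcases h _ this with h | h
        · simp [mul_inv_eq_one.1 h]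
        · simp [← h]
  have hz : (Finset.univ.filter fun x : G => x ^ (2 ^ 0) = 1).card ≤ 1 := by
    rw [Finset.card_le_one]
    simp +contextual
  have h1 := step 0
  have h2 := step 1
  have h3 := step 2
  have hH' : Nat.card H ≤ (Finset.univ.filter fun x : G => x ^ (2 ^ 3) = 1).card := by
    rw [Nat.card_eq_fintype_card, Fintype.card_subtype]
    apply Finset.card_le_card
    intro x hx
    simp only [Finset.mem_filter, Finset.mem_univ, true_and] at hx ⊢
    apply hcon
    have : (⟨x, hx⟩ : H) ^ Nat.card H = 1 := pow_card_eq_one'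
    rw [hH] at this
    simpa using congrArg Subtype.val this
  norm_num at *
  omega

/-- the curve `y² + xy = x³ + a` -/
def kcurve {F : Type*} [Field F] (a : F) : WeierstrassCurve.Affine F :=
  { a₁ := 1, a₂ := 0, a₃ := 0, a₄ := 0, a₆ := a }

theorem kcurve_ns {F : Type*} [Field F] [CharP F 2] (a : F) (ha : a ≠ 0) (x y : F) :
    (kcurve a).Nonsingular x y ↔ y ^ 2 + x * y = x ^ 3 + a := by
  have h2 : (2 : F) = 0 := CharTwo.two_eq_zero
  rw [WeierstrassCurve.Affine.nonsingular_iff', WeierstrassCurve.Affine.equation_iff]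
  simp only [kcurve, h2, zero_mul, one_mul, add_zero, zero_add]
  constructor
  · exact fun h => h.1
  · intro h
    refine ⟨h, ?_⟩
    by_contra hc
    push Not at hc
    obtain ⟨hy, rfl⟩ := hc
    have : y = 0 := by simpa using hy
    subst this
    apply ha
    simpa using h.symm

theorem kdouble {F : Type*} [Field F] [CharP F 2] [DecidableEq F] (a : F) (ha : a ≠ 0)
    (x y : F) (h : (kcurve a).Nonsingular x y) (hx : x ≠ 0) :
    ∃ (x' y' : F) (h' : (kcurve a).Nonsingular x' y'),
      WeierstrassCurve.Affine.Point.some x y h + WeierstrassCurve.Affine.Point.some x y h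
        = WeierstrassCurve.Affine.Point.some x' y' h' ∧
      x' * x ^ 2 = x ^ 4 + a ∧ ∃ l, x' = l ^ 2 + l := by
  have h2 : (2 : F) = 0 := CharTwo.two_eq_zero
  have hne : y ≠ (kcurve a).negY x y := by
    intro e
    apply hx
    simp only [WeierstrassCurve.Affine.negY, kcurve] at e
    linear_combination e - y * h2
  refine ⟨_, _, _, WeierstrassCurve.Affine.Point.add_self_of_Y_ne hne, ?_, ?_⟩
  · have he := (kcurve_ns a ha x y).1 h
    rw [WeierstrassCurve.Affine.slope_of_Y_ne rfl hne]
    have hd : y - (kcurve a).negY x y = x := by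
      simp only [WeierstrassCurve.Affine.negY, kcurve]
      linear_combination y * h2
    rw [hd]
    simp only [WeierstrassCurve.Affine.addX, kcurve]
    field_simp
    linear_combination he + (4 * x ^ 4 - 3 * x ^ 2 * y + x ^ 3 - x * y) * h2
  · refine ⟨(kcurve a).slope x x y y, ?_⟩
    simp only [WeierstrassCurve.Affine.addX, kcurve]
    linear_combination (-x) * h2

theorem kcount {F : Type*} [Field F] [CharP F 2] [Fintype F] [DecidableEq F] (m : ℕ)
    (hm : 0 < m) (hcard : Fintype.card F = 2 ^ m) (a : F) (ha : a ≠ 0) :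
    Finite (kcurve a).Point ∧ (Nat.card (kcurve a).Point : ℤ) = 2 ^ m + kloosterman m a := by
  classical
  have h2 : (2 : F) = 0 := CharTwo.two_eq_zero
  have hfr : ∀ x : F, x ^ 2 ^ m = x := fun x => by rw [← hcard]; exact FiniteField.pow_card x
  let A := Finset.univ.filter fun p : F × F => p.2 ^ 2 + p.1 * p.2 = p.1 ^ 3 + a
  let e : (kcurve a).Point ≃ Option A :=
    { toFun := fun P => match P with
        | .zero => none
        | .some x y h => some ⟨(x, y), by simpa [A] using (kcurve_ns a ha x y).1 h⟩
      invFun := fun o => match o with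
        | none => .zero
        | some p => .some p.1.1 p.1.2 ((kcurve_ns a ha _ _).2 (Finset.mem_filter.1 p.2).2)
      left_inv := by rintro (_ | _) <;> rfl
      right_inv := by rintro (_ | _) <;> rfl }
  refine ⟨Finite.of_equiv _ e.symm, ?_⟩
  rw [Nat.card_congr e, Nat.card_eq_fintype_card, Fintype.card_option, Fintype.card_coe]
  have hA : A.card = ∑ x : F, (Finset.univ.filter fun y : F => y ^ 2 + x * y = x ^ 3 + a).card := by
    simp only [A, Finset.card_filter]
    rw [Fintype.sum_prod_type]
  have h0 : (Finset.univ.filter fun y : F => y ^ 2 + 0 * y = 0 ^ 3 + a).card = 1 := by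
    obtain ⟨s, hs⟩ : ∃ s : F, s ^ 2 = a := by
      refine ⟨a ^ 2 ^ (m - 1), ?_⟩
      rw [← pow_mul, ← pow_succ, Nat.sub_add_cancel hm, hfr]
    rw [Finset.card_eq_one]
    refine ⟨s, ?_⟩
    ext y
    simp only [Finset.mem_filter, Finset.mem_univ, true_and, Finset.mem_singleton]
    constructor
    · intro h
      have : (y - s) ^ 2 = 0 := by linear_combination h - hs + (s ^ 2 - y * s) * h2
      exact sub_eq_zero.1 (pow_eq_zero_iff (by norm_num) |>.1 this)
    · rintro rfl
      rw [hs]; ring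
  have hx : ∀ x : F, x ≠ 0 → ((Finset.univ.filter fun y : F => y ^ 2 + x * y = x ^ 3 + a).card : ℤ)
      = 1 + sgn (absTrace m (x + a / x ^ 2)) := by
    intro x hx
    rw [← kas_card m hm hcard]
    congr 1
    symm
    apply Finset.card_bij (fun t _ => x * t)
    · intro t ht
      simp only [Finset.mem_filter, Finset.mem_univ, true_and] at ht ⊢
      have : x ^ 2 * (t ^ 2 + t) = x ^ 3 + a := by rw [ht]; field_simp
      linear_combination this
    · intro s _ t _ h
      exact mul_left_cancel₀ hx h
    · intro y hy
      simp only [Finset.mem_filter, Finset.mem_univ, true_and] at hy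
      refine ⟨y / x, ?_, by field_simp⟩
      simp only [Finset.mem_filter, Finset.mem_univ, true_and]
      field_simp
      linear_combination hy
  have hK : ∑ x ∈ Finset.univ.filter (fun x : F => x ≠ 0), sgn (absTrace m (x + a / x ^ 2)) =
      ∑ x ∈ Finset.univ.filter (fun x : F => x ≠ 0), sgn (absTrace m (x⁻¹ + a * x)) := by
    have hinj : ∀ x y : F, x ^ 2 = y ^ 2 → x = y := by
      intro x y h
      have : (x - y) ^ 2 = 0 := by linear_combination h + (y ^ 2 - x * y) * h2
      exact sub_eq_zero.1 (pow_eq_zero_iff (by norm_num) |>.1 this)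
    have hb : Finset.image (fun x : F => (x ^ 2)⁻¹) (Finset.univ.filter (fun x : F => x ≠ 0)) =
        Finset.univ.filter (fun x : F => x ≠ 0) := by
      apply Finset.eq_of_subset_of_card_le
      · intro x hx
        obtain ⟨y, hy, rfl⟩ := Finset.mem_image.1 hx
        simpa using hy
      · rw [Finset.card_image_of_injective]
        intro x y h
        exact hinj _ _ (inv_injective h)
    conv_rhs => rw [← hb]
    rw [Finset.sum_image]
    · refine Finset.sum_congr rfl fun x _ => ?_
      rw [inv_inv, ktr_add, ktr_add, ktr_sq m x (hfr x), div_eq_mul_inv]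
    · intro x _ y _ h
      exact hinj _ _ (inv_injective h)
  have hsplit : (A.card : ℤ) = 1 + ∑ x ∈ Finset.univ.filter (fun x : F => x ≠ 0),
      (1 + sgn (absTrace m (x + a / x ^ 2))) := by
    rw [hA]
    push_cast
    rw [← Finset.sum_filter_add_sum_filter_not Finset.univ (fun x : F => x = 0)]
    congr 1
    · rw [Finset.filter_eq', if_pos (Finset.mem_univ _), Finset.sum_singleton, h0]; rfl
    · exact Finset.sum_congr rfl fun x h => hx x (by simpa using h)
  have hc : ((Finset.univ.filter (fun x : F => x ≠ 0)).card : ℤ) = 2 ^ m - 1 := by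
    have h1 : (Finset.univ.filter (fun x : F => x ≠ 0)).card + 1 = 2 ^ m := by
      rw [← hcard, Finset.filter_ne', Finset.card_erase_of_mem (Finset.mem_univ _),
        Finset.card_univ]
      exact Nat.sub_add_cancel Fintype.card_pos
    have : ((Finset.univ.filter (fun x : F => x ≠ 0)).card : ℤ) + 1 = 2 ^ m := by exact_mod_cast h1
    linarith
  push_cast
  rw [hsplit, Finset.sum_add_distrib, hK, kloosterman, Finset.sum_const, nsmul_one, hc]
  ring

/-- If `m ≥ 4`, `a ∈ F_{2^m}` is nonzero and `16 ∣ K_{2^m}(a)`, then the absolute trace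
and the subtrace of `a` both vanish. -/
theorem stmt0 {F : Type*} [Field F] [Fintype F] [DecidableEq F] (m : ℕ)
    (hm : 4 ≤ m) (hcard : Fintype.card F = 2 ^ m) (a : F) (ha : a ≠ 0)
    (hdvd : (16 : ℤ) ∣ kloosterman m a) :
    absTrace m a = 0 ∧ subTrace m a = 0 := by
  have hp : Fact (Nat.Prime 2) := ⟨Nat.prime_two⟩
  have hch : CharP F 2 := charP_of_card_eq_prime_pow hcard
  have h2 : (2 : F) = 0 := CharTwo.two_eq_zero
  have hfr : ∀ x : F, x ^ 2 ^ m = x := fun x => by rw [← hcard]; exact FiniteField.pow_card x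
  obtain ⟨hfin, hN⟩ := kcount m (by omega) hcard a ha
  have hd : 16 ∣ Nat.card (kcurve a).Point := by
    have : (16 : ℤ) ∣ (Nat.card (kcurve a).Point : ℤ) := by
      rw [hN]
      refine dvd_add ?_ hdvd
      exact (by norm_num : (16 : ℤ) = 2 ^ 4) ▸ pow_dvd_pow 2 hm
    exact_mod_cast this
  obtain ⟨s, hs⟩ : ∃ s : F, s ^ 2 = a := by
    refine ⟨a ^ 2 ^ (m - 1), ?_⟩
    rw [← pow_mul, ← pow_succ, Nat.sub_add_cancel (by omega), hfr]
  have hsn : (kcurve a).Nonsingular 0 s := (kcurve_ns a ha 0 s).2 (by rw [hs]; ring)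
  -- a nonzero point whose double vanishes has `x = 0`
  have htor : ∀ P : (kcurve a).Point, P + P = 0 → P = 0 ∨ P = .some 0 s hsn := by
    rintro (_ | ⟨x, y, h⟩) hP
    · left; rfl
    · right
      have hx : x = 0 := by
        by_contra hx
        obtain ⟨x', y', h', e, -⟩ := kdouble a ha x y h hx
        rw [e] at hP
        exact WeierstrassCurve.Affine.Point.some_ne_zero _ hP
      subst hx
      have hy := (kcurve_ns a ha 0 y).1 h
      have : (y - s) ^ 2 = 0 := by linear_combination hy - hs + (s ^ 2 - y * s) * h2
      have := sub_eq_zero.1 (pow_eq_zero_iff (by norm_num) |>.1 this)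
      subst this
      rfl
  have hzz : WeierstrassCurve.Affine.Point.some 0 s hsn
      + WeierstrassCurve.Affine.Point.some 0 s hsn = 0 := by
    apply WeierstrassCurve.Affine.Point.add_self_of_Y_eq
    simp only [WeierstrassCurve.Affine.negY, kcurve]
    linear_combination s * h2
  obtain ⟨Q, hQ16, hQ8⟩ := kgroup (G := Multiplicative (kcurve a).Point)
    (Multiplicative.ofAdd (.some 0 s hsn))
    (fun x hx => by
      rw [pow_two] at hx
      exact htor x.toAdd hx)
    hd
  obtain ⟨P, rfl⟩ : ∃ P, Multiplicative.ofAdd P = Q := ⟨Q.toAdd, rfl⟩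
  have hP16 : (16 : ℕ) • P = 0 := hQ16
  have hP8 : (8 : ℕ) • P ≠ 0 := hQ8
  have key : ∀ R : (kcurve a).Point, R + R ≠ 0 → ∃ (x y : F) (h : (kcurve a).Nonsingular x y)
      (x' y' : F) (h' : (kcurve a).Nonsingular x' y'), x ≠ 0 ∧ R = .some x y h ∧
      R + R = .some x' y' h' ∧ x' * x ^ 2 = x ^ 4 + a ∧ ∃ l, x' = l ^ 2 + l := by
    rintro (_ | ⟨x, y, h⟩) hR
    · exact absurd (add_zero _) hR
    · have hx : x ≠ 0 := by
        rintro rfl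
        apply hR
        apply WeierstrassCurve.Affine.Point.add_self_of_Y_eq
        simp only [WeierstrassCurve.Affine.negY, kcurve]
        linear_combination y * h2
      obtain ⟨x', y', h', e⟩ := kdouble a ha x y h hx
      exact ⟨x, y, h, x', y', h', hx, rfl, e⟩
  have e2 : (2 : ℕ) • P = P + P := two_nsmul P
  have e4 : (4 : ℕ) • P = (2 : ℕ) • P + (2 : ℕ) • P := by rw [← add_nsmul]
  have e8 : (8 : ℕ) • P = (4 : ℕ) • P + (4 : ℕ) • P := by rw [← add_nsmul]
  have e16 : (16 : ℕ) • P = (8 : ℕ) • P + (8 : ℕ) • P := by rw [← add_nsmul]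
  have n8 : (4 : ℕ) • P + (4 : ℕ) • P ≠ 0 := e8 ▸ hP8
  have n4 : (2 : ℕ) • P + (2 : ℕ) • P ≠ 0 := by
    rw [← e4]; intro h; rw [h] at n8; exact n8 (add_zero _)
  have n2 : P + P ≠ 0 := by
    rw [← e2]; intro h; rw [h] at n4; exact n4 (add_zero _)
  have t8 : (8 : ℕ) • P = .some 0 s hsn := (htor _ (e16 ▸ hP16)).resolve_left hP8
  obtain ⟨-, -, -, x1', y1', h1', -, -, d1, -, l, hl⟩ := key _ n2
  obtain ⟨x1, y1, h1, x2', y2', h2', hx1, r1, d2, q2, -⟩ := key _ n4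
  obtain ⟨x2, y2, h22, x3', y3', h3', hx2, r2, d3, q3, -⟩ := key _ n8
  rw [← e2, r1] at d1
  rw [← e4, r2] at d2
  rw [← e8, t8] at d3
  obtain ⟨rfl, -⟩ := WeierstrassCurve.Affine.Point.some.inj d1
  obtain ⟨rfl, -⟩ := WeierstrassCurve.Affine.Point.some.inj d2
  obtain ⟨rfl, -⟩ := WeierstrassCurve.Affine.Point.some.inj d3
  refine kfinal m hfr a x2 x1 hx2 ?_ q2 ?_
  · linear_combination -q3 - a * h2
  · rw [hl, ktr_add, ktr_sq m l (hfr l)]; exact CharTwo.add_self_eq_zero _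
end

section
/- Let k be an odd integer with k ≥ 3, set m = 3k, and let a be a nonzero element of F_{2^{2m}}. Then the function f : F_{2^{2m}} → F_{2^k} given by f(x) = Tr^{2m}_k(a x^{2^m - 1}) is not bent. -/
/-- Relative trace `Tr^s_t(y) = Σ_{0 ≤ i < s/t} y^(2^(t i))` from `F_{2^s}` onto `F_{2^t}`. -/
def relTrace {F : Type*} [Field F] (t s : ℕ) (y : F) : F :=
  ∑ i ∈ Finset.range (s / t), y ^ (2 ^ (t * i))

/-- The Walsh transform `W_f(A, b) = Σ_{x} (-1)^{Tr^k_1(b f(x)) + Tr^n_1(A x)}` of a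
function `f` from `E = F_{2^n}` to the subfield `F_{2^k} ⊆ E`. -/
def walsh {E : Type*} [Field E] [Fintype E] [DecidableEq E]
    (n k : ℕ) (f : E → E) (A b : E) : ℤ :=
  ∑ x : E, sgn (absTrace k (b * f x) + absTrace n (A * x))

/-- `f : E = F_{2^n} → F_{2^k} ⊆ E` is bent if `|W_f(A, b)| = 2^(n/2)` for all `A ∈ E`
and all nonzero `b` in the subfield `F_{2^k} = {b : E | b^(2^k) = b}`. -/
def IsBent {E : Type*} [Field E] [Fintype E] [DecidableEq E] (n k : ℕ) (f : E → E) : Prop :=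
  ∀ A b : E, b ^ (2 ^ k) = b → b ≠ 0 → (walsh n k f A b).natAbs = 2 ^ (n / 2)


open Finset in
theorem aux_prim {E : Type*} [Field E] [Fintype E] (d : ℕ)
    (h : d ∣ Fintype.card E - 1) : ∃ z : E, IsPrimitiveRoot z d := by
  classical
  obtain ⟨g, hg⟩ := IsCyclic.exists_ofOrder_eq_natCard (α := Eˣ)
  rw [Nat.card_eq_fintype_card, Fintype.card_units] at hg
  obtain ⟨e, he⟩ := h
  have hpos : 0 < Fintype.card E - 1 := by
    have := Fintype.one_lt_card (α := E); omega
  have h1 : IsPrimitiveRoot g (Fintype.card E - 1) := hg ▸ IsPrimitiveRoot.orderOf g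
  have h2 : IsPrimitiveRoot (g ^ e) d := h1.pow hpos (by rw [he, mul_comm])
  exact ⟨((g ^ e : Eˣ) : E), h2.map_of_injective (f := Units.coeHom E) Units.val_injective⟩

open Finset in
theorem aux_card {E : Type*} [Field E] [Fintype E] [DecidableEq E] (d : ℕ) (hd : 0 < d)
    (h : d ∣ Fintype.card E - 1) : #{x : E | x ^ d = 1} = d := by
  obtain ⟨z, hz⟩ := aux_prim d h
  refine Eq.trans ?_ hz.card_nthRootsFinset
  congr 1
  ext x
  simp [Polynomial.mem_nthRootsFinset hd]

open Finset in
theorem aux_orth {E R : Type*} [Field E] [Fintype E] [DecidableEq E] [CommRing R] [IsDomain R]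
    (τ : E →* R) (hτ : Function.Injective τ) (d : ℕ) (hd : 0 < d)
    (h : d ∣ Fintype.card E - 1) (e e' : ℕ) :
    ∑ x ∈ univ.filter (fun x : E => x ^ d = 1), τ x ^ e * τ x⁻¹ ^ e'
      = if e ≡ e' [MOD d] then (d : R) else 0 := by
  obtain ⟨z, hz⟩ := aux_prim d h
  have hne : ∀ x : E, x ^ d = 1 → x ≠ 0 := by
    rintro x hx rfl
    rw [zero_pow hd.ne'] at hx
    exact zero_ne_one hx
  have hz0 := hne z hz.pow_eq_one
  split_ifs with hm
  · rw [Finset.sum_congr rfl (g := fun _ => (1 : R))]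
    · simp [aux_card d hd h]
    · intro x hx
      simp only [mem_filter, mem_univ, true_and] at hx
      have : x ^ e = x ^ e' := pow_eq_pow_of_modEq hm hx
      rw [← map_pow, this, map_pow, ← mul_pow, ← map_mul, mul_inv_cancel₀ (hne x hx), map_one,
        one_pow]
  · set S := ∑ x ∈ univ.filter (fun x : E => x ^ d = 1), τ x ^ e * τ x⁻¹ ^ e' with hS
    have h1 : S = τ z ^ e * τ z⁻¹ ^ e' * S := by
      conv_lhs => rw [hS]
      rw [hS, Finset.mul_sum]
      refine Finset.sum_bij' (fun x _ => z⁻¹ * x) (fun x _ => z * x) ?_ ?_ ?_ ?_ ?_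
      · intro x hx
        simp only [mem_filter, mem_univ, true_and] at hx ⊢
        rw [mul_pow, hx, inv_pow, hz.pow_eq_one]; simp
      · intro x hx
        simp only [mem_filter, mem_univ, true_and] at hx ⊢
        rw [mul_pow, hx, hz.pow_eq_one]; simp
      · intro x _; field_simp
      · intro x _; field_simp
      · intro x _
        obtain ⟨y, rfl⟩ : ∃ y, x = z * y := ⟨z⁻¹ * x, by field_simp⟩
        rw [inv_mul_cancel_left₀ hz0, mul_inv, map_mul, map_mul]
        ring
    by_contra hS0
    have h2 : τ z ^ e * τ z⁻¹ ^ e' = 1 := by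
      apply mul_right_cancel₀ hS0
      rw [← h1, one_mul]
    have h3 : z ^ e = z ^ e' := by
      apply hτ
      have h4 : τ z⁻¹ ^ e' * τ z ^ e' = 1 := by
        rw [← mul_pow, ← map_mul, inv_mul_cancel₀ hz0, map_one, one_pow]
      rw [map_pow, map_pow]
      calc τ z ^ e = τ z ^ e * (τ z⁻¹ ^ e' * τ z ^ e') := by rw [h4, mul_one]
        _ = τ z ^ e' := by rw [← mul_assoc, h2, one_mul]
    apply hm
    have hfin : IsOfFinOrder z := isOfFinOrder_iff_pow_eq_one.2 ⟨d, hd, hz.pow_eq_one⟩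
    have := hfin.pow_eq_pow_iff_modEq (n := e) (m := e')
    rw [← hz.eq_orderOf] at this
    exact this.1 h3

theorem aux_pow_le {i j k l : ℕ} (hij : i ≤ j) (hkl : k ≤ l)
    (h : 2 ^ i + 2 ^ j = 2 ^ k + 2 ^ l) : k ≤ i := by
  by_contra hlt
  push Not at hlt
  have hk : 2 ^ (i + 1) ∣ 2 ^ k := pow_dvd_pow 2 hlt
  have hl : 2 ^ (i + 1) ∣ 2 ^ l := pow_dvd_pow 2 (by omega)
  have hs : 2 ^ (i + 1) ∣ 2 ^ i + 2 ^ j := h ▸ dvd_add hk hl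
  rcases Nat.lt_or_ge i j with hj | hj
  · have hj : 2 ^ (i + 1) ∣ 2 ^ j := pow_dvd_pow 2 hj
    have := (Nat.dvd_add_left hj).1 hs
    have := (Nat.pow_dvd_pow_iff_le_right (x := 2) (by norm_num)).1 this
    omega
  · obtain rfl : i = j := le_antisymm hij hj
    have h1 := Nat.le_of_dvd (by positivity) hk
    have h2 := Nat.le_of_dvd (by positivity) hl
    have : 0 < 2 ^ i := by positivity
    rw [pow_succ] at h1 h2
    omega

theorem aux_pow_eq' {i j k l : ℕ} (hij : i ≤ j) (hkl : k ≤ l)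
    (h : 2 ^ i + 2 ^ j = 2 ^ k + 2 ^ l) : i = k ∧ j = l := by
  have h1 : i = k := le_antisymm (aux_pow_le hkl hij h.symm) (aux_pow_le hij hkl h)
  subst h1
  refine ⟨rfl, ?_⟩
  have : 2 ^ j = 2 ^ l := by omega
  exact Nat.pow_right_injective (le_refl 2) this

theorem aux_pow_eq {i j k l : ℕ} (h : 2 ^ i + 2 ^ j = 2 ^ k + 2 ^ l) :
    (i = k ∧ j = l) ∨ (i = l ∧ j = k) := by
  rcases le_total i j with hij | hij <;> rcases le_total k l with hkl | hkl
  · exact Or.inl (aux_pow_eq' hij hkl h)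
  · exact Or.inr (aux_pow_eq' hij hkl (by omega))
  · have := aux_pow_eq' hij hkl (by omega); tauto
  · have := aux_pow_eq' hij hkl (by omega); tauto

theorem aux_modEq {m i j k l : ℕ} (hi : i < m) (hj : j < m) (hk : k < m)
    (hl : l < m) : 2 ^ i + 2 ^ j ≡ 2 ^ k + 2 ^ l [MOD 2 ^ m - 1] ↔
      (i = k ∧ j = l) ∨ (i = l ∧ j = k) := by
  constructor
  · intro h
    apply aux_pow_eq
    have key : ∀ i, i < m → 1 ≤ 2 ^ i ∧ 2 * 2 ^ i ≤ 2 ^ m := by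
      intro i hi
      refine ⟨Nat.one_le_two_pow, ?_⟩
      rw [← pow_succ']
      exact Nat.pow_le_pow_right (by norm_num) hi
    have h1 := key i hi
    have h2 := key j hj
    have h3 := key k hk
    have h4 := key l hl
    rcases le_total (2 ^ i + 2 ^ j) (2 ^ k + 2 ^ l) with hle | hle
    · have := (Nat.modEq_iff_dvd' hle).1 h
      have := Nat.eq_zero_of_dvd_of_lt this (by omega)
      omega
    · have := (Nat.modEq_iff_dvd' hle).1 h.symm
      have := Nat.eq_zero_of_dvd_of_lt this (by omega)
      omega
  · rintro (⟨rfl, rfl⟩ | ⟨rfl, rfl⟩)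
    · rfl
    · rw [add_comm]

open Finset in
theorem aux_count {R : Type*} [CommRing R] {m k l : ℕ} (hk : k < m) (hl : l < m) (d : R) :
    ∑ p ∈ range m ×ˢ range m,
      (if 2 ^ p.1 + 2 ^ p.2 ≡ 2 ^ k + 2 ^ l [MOD 2 ^ m - 1] then d else 0)
      = d * (if k = l then 1 else 2) := by
  rw [← Finset.sum_filter]
  have : (range m ×ˢ range m).filter
      (fun p => 2 ^ p.1 + 2 ^ p.2 ≡ 2 ^ k + 2 ^ l [MOD 2 ^ m - 1]) = {(k, l), (l, k)} := by
    ext ⟨i, j⟩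
    simp only [mem_filter, mem_product, mem_range, mem_insert, mem_singleton, Prod.mk.injEq]
    constructor
    · rintro ⟨⟨hi, hj⟩, h⟩
      exact (aux_modEq hi hj hk hl).1 h
    · intro h
      have hi : i < m := by omega
      have hj : j < m := by omega
      exact ⟨⟨hi, hj⟩, (aux_modEq hi hj hk hl).2 h⟩
  rw [this]
  split_ifs with hkl
  · subst hkl; simp
  · rw [sum_pair (by simp; omega)]; ring

open Finset in
theorem aux_sq {R : Type*} [CommRing R] (n : ℕ) (x : ℕ → R) :
    ∃ r, (∑ i ∈ range n, x i) ^ 2 = ∑ i ∈ range n, x i ^ 2 + 2 * r := by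
  induction n with
  | zero => exact ⟨0, by simp⟩
  | succ n ih =>
    obtain ⟨r, hr⟩ := ih
    refine ⟨r + (∑ i ∈ range n, x i) * x n, ?_⟩
    rw [sum_range_succ, sum_range_succ, add_sq, hr]; ring

open Finset in
theorem aux_weighted {R : Type*} [CommRing R] (n : ℕ) (x : ℕ → R) :
    ∃ r, ∑ p ∈ range n ×ˢ range n, x p.1 * x p.2 * (if p.1 = p.2 then 1 else 2)
      = ∑ i ∈ range n, x i ^ 2 + 4 * r := by
  obtain ⟨r, hr⟩ := aux_sq n x
  refine ⟨r, ?_⟩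
  have h1 : ∀ p ∈ range n ×ˢ range n, x p.1 * x p.2 * (if p.1 = p.2 then (1 : R) else 2)
      = 2 * (x p.1 * x p.2) - (if p.1 = p.2 then x p.1 * x p.2 else 0) := by
    intro p _
    split_ifs <;> ring
  rw [sum_congr rfl h1, sum_sub_distrib, ← mul_sum, sum_product, sum_product]
  have h2 : ∑ i ∈ range n, ∑ j ∈ range n, (if i = j then x i * x j else 0)
      = ∑ i ∈ range n, x i ^ 2 := by
    apply sum_congr rfl
    intro i hi
    rw [sum_ite_eq, if_pos hi, sq]
  have h3 : ∑ i ∈ range n, ∑ j ∈ range n, x i * x j = (∑ i ∈ range n, x i) ^ 2 := by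
    rw [sq, sum_mul_sum]
  simp only at h2 h3 ⊢
  rw [h2, h3, hr]; ring

open Finset in
theorem aux_sumsq {E R : Type*} [Field E] [Fintype E] [DecidableEq E] [CommRing R] [IsDomain R]
    (τ : E →* R) (hτ : Function.Injective τ) (m : ℕ) (hm : 0 < m)
    (h : 2 ^ m - 1 ∣ Fintype.card E - 1) (c : E) :
    ∃ r, ∑ t ∈ univ.filter (fun x : E => x ^ (2 ^ m - 1) = 1),
      (∑ i ∈ range m, τ t ^ 2 ^ i) ^ 2 * (∑ i ∈ range m, τ (c * t⁻¹) ^ 2 ^ i) ^ 2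
      = ((2 ^ m - 1 : ℕ) : R) * ∑ i ∈ range m, τ c ^ 2 ^ (i + 1) + 4 * r := by
  have hd : 0 < 2 ^ m - 1 := by
    have : 2 ^ 1 ≤ 2 ^ m := Nat.pow_le_pow_right (by norm_num) hm
    omega
  obtain ⟨r, hr⟩ := aux_weighted m (fun i => τ c ^ 2 ^ i)
  refine ⟨((2 ^ m - 1 : ℕ) : R) * r, ?_⟩
  have e1 : ∀ x : R, (∑ i ∈ range m, x ^ 2 ^ i) ^ 2
      = ∑ p ∈ range m ×ˢ range m, x ^ (2 ^ p.1 + 2 ^ p.2) := by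
    intro x
    rw [sq, sum_mul_sum, sum_product]
    simp only [pow_add]
  have e2 : ∀ t : E, (∑ i ∈ range m, τ t ^ 2 ^ i) ^ 2 * (∑ i ∈ range m, τ (c * t⁻¹) ^ 2 ^ i) ^ 2
      = ∑ s ∈ range m ×ˢ range m, ∑ p ∈ range m ×ˢ range m,
        τ c ^ (2 ^ s.1 + 2 ^ s.2) *
        (τ t ^ (2 ^ p.1 + 2 ^ p.2) * τ t⁻¹ ^ (2 ^ s.1 + 2 ^ s.2)) := by
    intro t
    rw [e1, e1, mul_comm, sum_mul_sum]
    refine sum_congr rfl fun s _ => sum_congr rfl fun p _ => ?_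
    rw [map_mul]; ring
  simp only [e2]
  rw [sum_comm]
  have e3 : ∀ s ∈ range m ×ˢ range m,
      ∑ t ∈ univ.filter (fun x : E => x ^ (2 ^ m - 1) = 1), ∑ p ∈ range m ×ˢ range m,
        τ c ^ (2 ^ s.1 + 2 ^ s.2) *
        (τ t ^ (2 ^ p.1 + 2 ^ p.2) * τ t⁻¹ ^ (2 ^ s.1 + 2 ^ s.2))
      = ((2 ^ m - 1 : ℕ) : R) *
        (τ c ^ 2 ^ s.1 * τ c ^ 2 ^ s.2 * (if s.1 = s.2 then 1 else 2)) := by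
    intro s hs
    rw [mem_product, mem_range, mem_range] at hs
    rw [sum_comm]
    simp only [← mul_sum, aux_orth τ hτ _ hd h]
    rw [aux_count hs.1 hs.2, pow_add]
    ring
  rw [sum_congr rfl e3, ← mul_sum, hr]
  simp only [← pow_mul, ← pow_succ]
  ring

open Finset in
theorem aux_trace_01 {E : Type*} [Field E] [CharP E 2] (m : ℕ) (t : E) (ht : t ^ 2 ^ m = t) :
    absTrace m t = 0 ∨ absTrace m t = 1 := by
  have h : absTrace m t ^ 2 = absTrace m t := by
    unfold absTrace
    rw [CharTwo.sum_sq]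
    simp only [← pow_mul, ← pow_succ]
    have := sum_range_succ' (fun i => t ^ 2 ^ i) m
    rw [sum_range_succ, ht, pow_zero, pow_one] at this
    exact (add_right_cancel this).symm
  have : absTrace m t * (absTrace m t - 1) = 0 := by linear_combination h
  rcases mul_eq_zero.1 this with h | h
  · exact Or.inl h
  · exact Or.inr (sub_eq_zero.1 h)

theorem aux_ind {E R : Type*} [Field E] [CharP E 2] [DecidableEq E] [CommRing R]
    (τ : E →* R) (π : R →+* E) (hπ : ∀ x, π (τ x) = x) (hker : ∀ r, π r = 0 → 2 ∣ r)
    (m : ℕ) (t : E) (ht : t ^ 2 ^ m = t) :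
    ∃ r, (∑ i ∈ Finset.range m, τ t ^ 2 ^ i) ^ 2
      = (if absTrace m t ≠ 0 then 1 else 0) + 4 * r := by
  have h0 : π (∑ i ∈ Finset.range m, τ t ^ 2 ^ i) = absTrace m t := by
    simp [absTrace, map_sum, hπ]
  rcases aux_trace_01 m t ht with h | h
  · obtain ⟨r, hr⟩ := hker _ (h0.trans h)
    rw [hr, h]
    exact ⟨r ^ 2, by simp; ring⟩
  · obtain ⟨r, hr⟩ := hker (∑ i ∈ Finset.range m, τ t ^ 2 ^ i - 1) (by rw [map_sub, h0, h]; simp)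
    rw [eq_add_of_sub_eq hr, h]
    exact ⟨r ^ 2 + r, by simp; ring⟩

open Finset in
theorem aux_M {E R : Type*} [Field E] [CharP E 2] [Fintype E] [DecidableEq E] [CommRing R]
    [IsDomain R]
    (τ : E →* R) (π : R →+* E) (hπ : ∀ x, π (τ x) = x) (hker : ∀ r, π r = 0 → 2 ∣ r)
    (m : ℕ) (hm : 2 ≤ m) (h : 2 ^ m - 1 ∣ Fintype.card E - 1) (c : E) (hc : c ^ 2 ^ m = c)
    (h4 : 4 ∣ #{t : E | t ^ (2 ^ m - 1) = 1 ∧ absTrace m t ≠ 0 ∧ absTrace m (c * t⁻¹) ≠ 0}) :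
    (4 : R) ∣ ∑ i ∈ range m, τ c ^ 2 ^ (i + 1) := by
  have hτ : Function.Injective τ := Function.LeftInverse.injective hπ
  obtain ⟨r, hr⟩ := aux_sumsq τ hτ m (by omega) h c
  have hle : 1 ≤ 2 ^ m := Nat.one_le_two_pow
  have hterm : ∀ t ∈ univ.filter (fun x : E => x ^ (2 ^ m - 1) = 1),
      ∃ s, (∑ i ∈ range m, τ t ^ 2 ^ i) ^ 2 * (∑ i ∈ range m, τ (c * t⁻¹) ^ 2 ^ i) ^ 2
        = (if absTrace m t ≠ 0 ∧ absTrace m (c * t⁻¹) ≠ 0 then 1 else 0) + 4 * s := by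
    intro t ht
    simp only [mem_filter, mem_univ, true_and] at ht
    have ht' : t ^ 2 ^ m = t := by
      conv_lhs => rw [← Nat.sub_add_cancel hle, pow_succ, ht, one_mul]
    obtain ⟨s1, h1⟩ := aux_ind τ π hπ hker m t ht'
    obtain ⟨s2, h2⟩ := aux_ind τ π hπ hker m (c * t⁻¹) (by rw [mul_pow, inv_pow, ht', hc])
    rw [h1, h2]
    by_cases ha : absTrace m t ≠ 0 <;> by_cases hb : absTrace m (c * t⁻¹) ≠ 0
    · exact ⟨s1 + s2 + 4 * s1 * s2, by simp [ha, hb]; ring⟩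
    · exact ⟨s2 + 4 * s1 * s2, by simp [ha, hb]; ring⟩
    · exact ⟨s1 + 4 * s1 * s2, by simp [ha, hb]; ring⟩
    · exact ⟨4 * s1 * s2, by simp [ha, hb]; ring⟩
  choose! s hs using hterm
  rw [sum_congr rfl hs, sum_add_distrib, ← mul_sum, ← sum_filter, filter_filter, sum_const,
    nsmul_one] at hr
  generalize (∑ i ∈ univ.filter (fun x : E => x ^ (2 ^ m - 1) = 1), s i) = w at hr
  obtain ⟨M, hM⟩ := h4
  rw [hM] at hr
  obtain ⟨u, hu⟩ : ∃ u, 2 ^ m = 4 * u := by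
    obtain ⟨v, rfl⟩ := Nat.exists_eq_add_of_le hm
    exact ⟨2 ^ v, by rw [pow_add]; norm_num⟩
  rw [Nat.cast_sub hle, hu] at hr
  push_cast at hr
  refine ⟨u * ∑ i ∈ range m, τ c ^ 2 ^ (i + 1) - M + r - w, ?_⟩
  linear_combination hr

theorem aux_modEq1 {k i j : ℕ} (hi : i < k) (hj : j < k) :
    2 ^ (i + 1) ≡ 2 ^ (j + 1) [MOD 2 ^ k - 1] ↔ i = j := by
  have := aux_modEq (m := k) hi hi hj hj
  rw [← two_mul, ← two_mul, ← pow_succ', ← pow_succ'] at this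
  rw [this]; omega

open Finset in
theorem aux_split {R : Type*} [CommRing R] (k n : ℕ) (f : ℕ → R) :
    ∑ i ∈ range (n * k), f i = ∑ j ∈ range k, ∑ s ∈ range n, f (s * k + j) := by
  rw [sum_comm]
  induction n with
  | zero => simp
  | succ n ih => rw [Nat.succ_mul, sum_range_add, ih, sum_range_succ]

theorem aux_frob_fix {S : Type*} [Monoid S] (k : ℕ) (x : S) (hx : x ^ 2 ^ k = x) (s j : ℕ) :
    x ^ 2 ^ (s * k + j) = x ^ 2 ^ j := by
  induction s with
  | zero => simp
  | succ s ih => rw [show (s + 1) * k + j = k + (s * k + j) by ring, pow_add, pow_mul, hx, ih]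

open Finset in
theorem aux_A {E R : Type*} [Field E] [Fintype E] [DecidableEq E] [CommRing R] [IsDomain R]
    (τ : E →* R) (hτ : Function.Injective τ) (k : ℕ) (hk : 3 ≤ k)
    (h : 2 ^ k - 1 ∣ Fintype.card E - 1) (α : E)
    (hα : ∀ b : E, b ^ (2 ^ k - 1) = 1 → (4 : R) ∣ ∑ i ∈ range (3 * k), τ (α * b) ^ 2 ^ (i + 1))
    (e : ℕ) (he : e < k) :
    (4 : R) ∣ (2 ^ k - 1 : R) * ∑ s ∈ range 3, τ α ^ 2 ^ (s * k + (e + 1)) := by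
  have hle : 2 ^ 3 ≤ 2 ^ k := Nat.pow_le_pow_right (by norm_num) hk
  have hd : 0 < 2 ^ k - 1 := by omega
  have h1 : (4 : R) ∣ ∑ b ∈ univ.filter (fun x : E => x ^ (2 ^ k - 1) = 1),
      τ b⁻¹ ^ 2 ^ (e + 1) * ∑ i ∈ range (3 * k), τ (α * b) ^ 2 ^ (i + 1) := by
    apply dvd_sum
    intro b hb
    simp only [mem_filter, mem_univ, true_and] at hb
    exact (hα b hb).mul_left _
  have h2 : ∀ b ∈ univ.filter (fun x : E => x ^ (2 ^ k - 1) = 1),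
      τ b⁻¹ ^ 2 ^ (e + 1) * ∑ i ∈ range (3 * k), τ (α * b) ^ 2 ^ (i + 1)
      = ∑ j ∈ range k, (∑ s ∈ range 3, τ α ^ 2 ^ (s * k + (j + 1))) *
        (τ b ^ 2 ^ (j + 1) * τ b⁻¹ ^ 2 ^ (e + 1)) := by
    intro b hb
    simp only [mem_filter, mem_univ, true_and] at hb
    have hb' : τ b ^ 2 ^ k = τ b := by
      rw [← map_pow]
      conv_lhs => rw [← Nat.sub_add_cancel (show 1 ≤ 2 ^ k by omega), pow_succ, hb, one_mul]
    rw [aux_split, mul_sum]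
    refine sum_congr rfl fun j _ => ?_
    rw [sum_mul, mul_sum]
    refine sum_congr rfl fun s _ => ?_
    rw [map_mul, mul_pow, add_assoc, aux_frob_fix k (τ b) hb']
    ring
  rw [sum_congr rfl h2, sum_comm] at h1
  simp only [← mul_sum, aux_orth τ hτ _ hd h] at h1
  rw [sum_eq_single_of_mem e (mem_range.2 he), if_pos (Nat.ModEq.refl _), Nat.cast_sub (by omega)] at h1
  · push_cast at h1
    rwa [mul_comm] at h1
  · intro j hj hne
    rw [mem_range] at hj
    rw [if_neg, mul_zero]
    rw [aux_modEq1 hj he]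
    exact hne

theorem aux_A' {R : Type*} [CommRing R] (k : ℕ) (hk : 3 ≤ k) (x : R)
    (h : (4 : R) ∣ (2 ^ k - 1 : R) * x) : (4 : R) ∣ x := by
  obtain ⟨v, rfl⟩ := Nat.exists_eq_add_of_le hk
  obtain ⟨r, hr⟩ := h
  exact ⟨2 ^ (v + 1) * x - r, by rw [mul_sub, ← hr]; ring⟩

open Finset in
theorem aux_final {E R : Type*} [Field E] [CharP E 2] [Fintype E] [DecidableEq E] [CommRing R]
    [IsDomain R] (h2 : (2 : R) ≠ 0)
    (τ : E →* R) (π : R →+* E) (hπ : ∀ x, π (τ x) = x)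
    (k : ℕ) (hk : 3 ≤ k) (hodd : Odd k)
    (h : 2 ^ k - 1 ∣ Fintype.card E - 1) (α : E) (hα0 : α ≠ 0) (hαq : α ^ 2 ^ (3 * k) = α)
    (hα : ∀ b : E, b ^ (2 ^ k - 1) = 1 → (4 : R) ∣ ∑ i ∈ range (3 * k), τ (α * b) ^ 2 ^ (i + 1)) :
    False := by
  have hτ : Function.Injective τ := Function.LeftInverse.injective hπ
  have a0 := aux_A' k hk _ (aux_A τ hτ k hk h α hα 0 (by omega))
  have a1 := aux_A' k hk _ (aux_A τ hτ k hk h α hα 1 (by omega))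
  set x := α ^ 2 with hx
  set y := x ^ 2 ^ k with hy
  set z := y ^ 2 ^ k with hz
  have e0 : ∑ s ∈ range 3, τ α ^ 2 ^ (s * k + (0 + 1)) = τ x + τ y + τ z := by
    simp only [sum_range_succ, hz, hy, hx, map_pow, ← pow_mul, ← pow_add, ← pow_succ']
    simp only [range_zero, sum_empty, pow_succ, pow_zero]
    ring_nf
  have e1 : ∑ s ∈ range 3, τ α ^ 2 ^ (s * k + (1 + 1)) = τ x ^ 2 + τ y ^ 2 + τ z ^ 2 := by
    simp only [sum_range_succ, hz, hy, hx, map_pow, ← pow_mul, ← pow_add, ← pow_succ']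
    simp only [range_zero, sum_empty, pow_succ, pow_zero]
    ring_nf
  rw [e0] at a0
  rw [e1] at a1
  obtain ⟨u, hu⟩ := a0
  obtain ⟨v, hv⟩ := a1
  have h3 : τ x * τ y + τ y * τ z + τ z * τ x = 2 * (4 * u ^ 2 - v) := by
    apply mul_left_cancel₀ h2
    linear_combination (τ x + τ y + τ z + 4 * u) * hu - hv
  have two : (2 : E) = 0 := CharTwo.two_eq_zero
  have p1 : x + y + z = 0 := by
    have := congrArg π hu
    simp only [map_add, map_mul, hπ] at this
    rw [this, show (4 : R) = 2 * 2 by norm_num, map_mul, map_ofNat, two]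
    simp
  have p2 : x * y + y * z + z * x = 0 := by
    have := congrArg π h3
    simp only [map_add, map_mul, hπ] at this
    rw [this, map_ofNat, two, zero_mul]
  have hx0 : x ≠ 0 := pow_ne_zero 2 hα0
  have p3 : x ^ 3 = y ^ 3 := by
    linear_combination (x - y) * (x + y) * p1 - (x - y) * p2
  -- cube roots are unique
  have hr3 : (y / x) ^ 3 = 1 := by rw [div_pow, ← p3, div_self (pow_ne_zero 3 hx0)]
  have hrq : (y / x) ^ 2 ^ (3 * k) = y / x := by
    have hxq : x ^ 2 ^ (3 * k) = x := by rw [hx, ← pow_mul, mul_comm, pow_mul, hαq]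
    rw [div_pow, hxq, hy, ← pow_mul, mul_comm, pow_mul, hxq]
  obtain ⟨j, hj⟩ : ∃ j, 2 ^ (3 * k) = 3 * j + 2 := by
    have ho : Odd (3 * k) := Odd.mul (by decide) hodd
    obtain ⟨w, hw⟩ := ho
    have : 2 ^ (3 * k) % 3 = 2 := by
      rw [hw, pow_succ, pow_mul, Nat.mul_mod, Nat.pow_mod]; norm_num
    exact ⟨2 ^ (3 * k) / 3, by omega⟩
  have hr1 : y / x = 1 := by
    rw [hj, pow_add, pow_mul, hr3, one_pow, one_mul] at hrq
    have hne : y / x ≠ 0 := by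
      intro h0
      rw [h0] at hr3
      norm_num at hr3
    apply mul_left_cancel₀ hne
    rw [mul_one, ← sq, hrq]
  have hxy : y = x := by rwa [div_eq_one_iff_eq hx0] at hr1
  have hzx : z = x := by rw [hz, hxy, ← hy, hxy]
  rw [hzx, hxy] at p1
  apply hx0
  linear_combination p1 - x * two

theorem aux_witt {E : Type*} [Field E] [Finite E] [CharP E 2] :
    (2 : WittVector 2 E) ≠ 0 ∧
    (∀ x : E, WittVector.constantCoeff (WittVector.teichmuller 2 x) = x) ∧
    (∀ r : WittVector 2 E, WittVector.constantCoeff r = 0 → 2 ∣ r) := by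
  have : Fact (Nat.Prime 2) := ⟨Nat.prime_two⟩
  refine ⟨?_, ?_, ?_⟩
  · have := WittVector.p_nonzero 2 E
    exact_mod_cast this
  · intro x; exact WittVector.teichmuller_coeff_zero 2 x
  · intro r hr
    have : r ∈ RingHom.ker (WittVector.constantCoeff : WittVector 2 E →+* E) := hr
    rw [WittVector.ker_constantCoeff, Ideal.mem_span_singleton] at this
    exact_mod_cast this

theorem aux_tr_add {E : Type*} [Field E] [CharP E 2] (m : ℕ) (x y : E) :
    absTrace m (x + y) = absTrace m x + absTrace m y := by
  unfold absTrace
  rw [← Finset.sum_add_distrib]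
  exact Finset.sum_congr rfl fun i _ => add_pow_char_pow x y 2 i

theorem aux_tr_zero {E : Type*} [Field E] (m : ℕ) : absTrace m (0 : E) = 0 := by
  unfold absTrace
  exact Finset.sum_eq_zero fun i _ => zero_pow (by positivity)

theorem aux_tr_double {E : Type*} [Field E] (m : ℕ) (x : E) :
    absTrace (2 * m) x = absTrace m x + absTrace m (x ^ 2 ^ m) := by
  unfold absTrace
  rw [two_mul, Finset.sum_range_add]
  simp only [pow_add, pow_mul]

theorem aux_tele {E : Type*} [Field E] [CharP E 2] (m : ℕ) (y : E) :
    absTrace m (y ^ 2 + y) = y ^ 2 ^ m + y := by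
  induction m with
  | zero => simp [absTrace, CharTwo.add_self_eq_zero]
  | succ m ih =>
    unfold absTrace at ih ⊢
    rw [Finset.sum_range_succ, ih, add_pow_char_pow, ← pow_mul, ← pow_succ']
    linear_combination (y ^ 2 ^ m) * (CharTwo.two_eq_zero : (2 : E) = 0)

theorem aux_L1 {E : Type*} [Field E] [CharP E 2] (m : ℕ) (hm : 0 < m) (c x : E)
    (hc : c ^ 2 ^ m = c) (hx : (x ^ 2 ^ m) ^ 2 ^ m = x) :
    absTrace (2 * m) (c * x ^ (2 ^ m - 1))
      = absTrace m (c * (x * x ^ 2 ^ m / (x + x ^ 2 ^ m) ^ 2)⁻¹) := by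
  have hle : 2 ^ 1 ≤ 2 ^ m := Nat.pow_le_pow_right (by norm_num) hm
  by_cases h0 : x = 0
  · subst h0
    rw [zero_pow (by omega)]; simp [aux_tr_zero]
  · have hw : x ^ (2 ^ m - 1) = x ^ 2 ^ m / x := by
      rw [eq_div_iff h0, ← pow_succ, Nat.sub_add_cancel (by omega)]
    have hq0 : x ^ 2 ^ m ≠ 0 := pow_ne_zero _ h0
    rw [hw, aux_tr_double, ← aux_tr_add, mul_pow, hc, div_pow, hx]
    congr 1
    rw [inv_div, CharTwo.add_sq]
    field_simp
    ring

theorem aux_surj {E : Type*} [Field E] [CharP E 2] [Fintype E] (m : ℕ) (hm : Odd m)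
    (h3 : 3 ∣ Fintype.card E - 1) (t : E) (ht : t ^ 2 ^ m = t) (htr : absTrace m t = 1) :
    ∃ y : E, y ^ 2 + y = t ∧ y ^ 2 ^ m = y + 1 := by
  have two : (2 : E) = 0 := CharTwo.two_eq_zero
  obtain ⟨w, hw⟩ := aux_prim (E := E) 3 h3
  have hw3 := hw.pow_eq_one
  have hw1 : w ≠ 1 := hw.ne_one (by norm_num)
  have hww : w ^ 2 + w = 1 := by
    have : (w - 1) * (w ^ 2 + w + 1) = 0 := by linear_combination hw3
    rcases mul_eq_zero.1 this with h | h
    · exact absurd (sub_eq_zero.1 h) hw1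
    · linear_combination h - two
  obtain ⟨h, rfl⟩ := hm
  have key : ∀ n : ℕ, (∑ i ∈ Finset.range n, t ^ 2 ^ (2 * i)) ^ 2
      + ∑ i ∈ Finset.range n, t ^ 2 ^ (2 * i) = ∑ i ∈ Finset.range (2 * n), t ^ 2 ^ i := by
    intro n
    induction n with
    | zero => simp
    | succ n ih =>
      rw [show 2 * (n + 1) = 2 * n + 1 + 1 by ring, Finset.sum_range_succ, Finset.sum_range_succ,
        Finset.sum_range_succ, ← ih, CharTwo.add_sq, ← pow_mul, ← pow_succ]
      ring
  have hy : ∃ y : E, y ^ 2 + y = t := by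
    refine ⟨∑ i ∈ Finset.range (h + 1), t ^ 2 ^ (2 * i) + w, ?_⟩
    have := key (h + 1)
    rw [show 2 * (h + 1) = 2 * h + 1 + 1 by ring, Finset.sum_range_succ (n := 2 * h + 1), ht] at this
    unfold absTrace at htr
    rw [htr] at this
    rw [CharTwo.add_sq]
    linear_combination this + hww + two
  obtain ⟨y, hy⟩ := hy
  refine ⟨y, hy, ?_⟩
  have := aux_tele (2 * h + 1) y
  rw [hy, htr] at this
  linear_combination -this - y * two

open Finset in
theorem aux_red {E : Type*} [Field E] [CharP E 2] [Fintype E] [DecidableEq E] (m : ℕ)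
    (hm : Odd m) (hcard : Fintype.card E = 2 ^ (2 * m)) (h3 : 3 ∣ Fintype.card E - 1)
    (hd : 2 ^ m - 1 ∣ Fintype.card E - 1)
    (c : E) (hc : c ^ 2 ^ m = c) :
    #{x : E | absTrace (2 * m) (c * x ^ (2 ^ m - 1)) ≠ 0}
    = #{t : E | t ^ (2 ^ m - 1) = 1 ∧ absTrace m t ≠ 0 ∧ absTrace m (c * t⁻¹) ≠ 0}
      * (2 * (2 ^ m - 1)) := by
  have two : (2 : E) = 0 := CharTwo.two_eq_zero
  have hmpos : 0 < m := hm.pos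
  have hle : 2 ^ 1 ≤ 2 ^ m := Nat.pow_le_pow_right (by norm_num) hmpos
  have hqq : ∀ x : E, (x ^ 2 ^ m) ^ 2 ^ m = x := by
    intro x
    rw [← pow_mul, ← pow_add, ← two_mul, ← hcard, FiniteField.pow_card]
  have hfix : ∀ t : E, t ≠ 0 → t ^ 2 ^ m = t → t ^ (2 ^ m - 1) = 1 := by
    intro t h0 ht
    apply mul_right_cancel₀ h0
    rw [← pow_succ, Nat.sub_add_cancel (by omega), ht, one_mul]
  have hfix' : ∀ t : E, t ^ (2 ^ m - 1) = 1 → t ≠ 0 ∧ t ^ 2 ^ m = t := by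
    intro t ht
    constructor
    · rintro rfl
      rw [zero_pow (by omega)] at ht
      exact zero_ne_one ht
    · conv_lhs => rw [← Nat.sub_add_cancel (show 1 ≤ 2 ^ m by omega), pow_succ, ht, one_mul]
  set φ : E → E := fun x => x * x ^ 2 ^ m / (x + x ^ 2 ^ m) ^ 2 with hφ
  have hL1 : ∀ x : E, absTrace (2 * m) (c * x ^ (2 ^ m - 1)) = absTrace m (c * (φ x)⁻¹) :=
    fun x => aux_L1 m hmpos c x hc (hqq x)
  simp only [hL1]
  -- basic facts about points with nonzero trace
  have hbasic : ∀ x : E, absTrace m (c * (φ x)⁻¹) ≠ 0 →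
      φ x ≠ 0 ∧ x ≠ 0 ∧ x + x ^ 2 ^ m ≠ 0 := by
    intro x hx
    have h1 : φ x ≠ 0 := by
      intro h0
      rw [h0, inv_zero, mul_zero, aux_tr_zero] at hx
      exact hx rfl
    refine ⟨h1, ?_, ?_⟩
    · rintro rfl
      simp [hφ] at h1
    · intro h0
      simp [hφ, h0] at h1
  have hrfix : ∀ x : E, (x + x ^ 2 ^ m) ^ 2 ^ m = x + x ^ 2 ^ m := by
    intro x
    rw [add_pow_char_pow, hqq, add_comm]
  have hysq : ∀ x : E, x + x ^ 2 ^ m ≠ 0 →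
      (x / (x + x ^ 2 ^ m)) ^ 2 + x / (x + x ^ 2 ^ m) = φ x := by
    intro x hx
    simp only [hφ]
    field_simp
    linear_combination x ^ 2 * two
  rw [card_eq_sum_card_fiberwise (f := φ)
    (t := {t : E | t ^ (2 ^ m - 1) = 1 ∧ absTrace m t ≠ 0 ∧ absTrace m (c * t⁻¹) ≠ 0})]
  · rw [sum_const_nat]
    intro t ht
    simp only [mem_filter, mem_univ, true_and] at ht
    obtain ⟨ht1, ht2, ht3⟩ := ht
    obtain ⟨ht0, htq⟩ := hfix' t ht1
    have htr : absTrace m t = 1 := (aux_trace_01 m t htq).resolve_left ht2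
    obtain ⟨y, hy, hyq⟩ := aux_surj m hm h3 t htq htr
    have hG := aux_card (E := E) (2 ^ m - 1) (by omega) hd
    have hprod : #(({0, 1} : Finset E) ×ˢ ({x : E | x ^ (2 ^ m - 1) = 1} : Finset E))
        = 2 * (2 ^ m - 1) := by
      rw [card_product, hG, card_pair zero_ne_one]
    rw [← hprod]
    symm
    have hcomp : ∀ e r : E, (e = 0 ∨ e = 1) → r ^ (2 ^ m - 1) = 1 →
        r * (y + e) + (r * (y + e)) ^ 2 ^ m = r := by
      intro e r he hr
      have heq : e ^ 2 ^ m = e := by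
        rcases he with rfl | rfl
        · exact zero_pow (by positivity)
        · exact one_pow _
      rw [mul_pow, add_pow_char_pow, hyq, heq, (hfix' r hr).2]
      linear_combination (r * y + r * e) * two
    refine card_bij (fun p _ => p.2 * (y + p.1)) ?_ ?_ ?_
    · rintro ⟨e, r⟩ hp
      simp only [mem_product, mem_insert, mem_singleton, mem_filter, mem_univ, true_and] at hp
      obtain ⟨he, hr⟩ := hp
      have hs := hcomp e r he hr
      have hr0 := (hfix' r hr).1
      have hφt : φ (r * (y + e)) = t := by
        rw [← hysq _ (by rw [hs]; exact hr0), hs, mul_div_cancel_left₀ _ hr0, ← hy]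
        rcases he with rfl | rfl
        · ring
        · linear_combination (y + 1) * two
      simp only [mem_filter, mem_univ, true_and]
      rw [hφt]
      exact ⟨ht3, rfl⟩
    · rintro ⟨e, r⟩ hp ⟨e', r'⟩ hp' heq
      simp only [mem_product, mem_insert, mem_singleton, mem_filter, mem_univ, true_and] at hp hp'
      simp only at heq
      have h1 := hcomp e r hp.1 hp.2
      have h2 := hcomp e' r' hp'.1 hp'.2
      rw [heq, h2] at h1
      subst h1
      have := add_left_cancel (mul_left_cancel₀ (hfix' _ hp.2).1 heq)
      rw [this]
    · intro x hx
      simp only [mem_filter, mem_univ, true_and] at hx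
      obtain ⟨hx1, hx2⟩ := hx
      obtain ⟨b1, b2, b3⟩ := hbasic x hx1
      have hsq := hysq x b3
      rw [hx2, ← hy] at hsq
      refine ⟨(x / (x + x ^ 2 ^ m) + y, x + x ^ 2 ^ m), ?_, ?_⟩
      · simp only [mem_product, mem_insert, mem_singleton, mem_filter, mem_univ, true_and]
        refine ⟨?_, hfix _ b3 (hrfix x)⟩
        generalize x / (x + x ^ 2 ^ m) = v at hsq
        have : (v + y) * (v + y - 1) = 0 := by
          linear_combination hsq + (v * y + y ^ 2 - v) * two
        rcases mul_eq_zero.1 this with h | h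
        · exact Or.inl h
        · exact Or.inr (sub_eq_zero.1 h)
      · simp only
        rw [mul_add, mul_add, mul_div_cancel₀ _ b3]
        linear_combination ((x + x ^ 2 ^ m) * y) * two
  · intro x hx
    simp only [coe_filter, mem_univ, true_and, Set.mem_ofPred_eq] at hx ⊢
    obtain ⟨b1, b2, b3⟩ := hbasic x hx
    refine ⟨hfix _ b1 ?_, ?_, hx⟩
    · simp only [hφ]
      rw [div_pow, mul_pow, hqq, ← pow_mul, mul_comm 2, pow_mul, hrfix, mul_comm x]
    · rw [← hysq x b3, aux_tele, div_pow, hrfix, ← add_div, add_comm, div_self b3]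
      exact one_ne_zero

open Finset in
theorem aux_rel {E : Type*} [Field E] [CharP E 2] (k m : ℕ) (hk : 3 ≤ k) (hm : m = 3 * k)
    (b y : E) (hb : b ^ 2 ^ k = b) :
    absTrace k (b * relTrace k (2 * m) y) = absTrace (2 * m) (b * y) := by
  have h6 : 2 * m / k = 6 := by
    rw [hm, ← mul_assoc]; exact Nat.mul_div_cancel _ (by omega)
  unfold absTrace relTrace
  rw [h6, show 2 * m = 6 * k by omega, aux_split]
  refine sum_congr rfl fun j _ => ?_
  rw [mul_sum, sum_pow_char_pow]
  refine sum_congr rfl fun i _ => ?_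
  have := aux_frob_fix k b hb i 0
  rw [add_zero, pow_zero, pow_one] at this
  rw [pow_add, pow_mul (b * y), mul_pow b y, this, mul_comm k i]

open Finset in
theorem aux_sgn {E : Type*} [Field E] [Fintype E] [DecidableEq E] (g : E → E) :
    ∑ x : E, sgn (g x) = (Fintype.card E : ℤ) - 2 * (#{x : E | g x ≠ 0} : ℤ) := by
  have h : ∀ x : E, sgn (g x) = 1 - 2 * (if g x ≠ 0 then 1 else 0) := by
    intro x
    unfold sgn
    split_ifs <;> simp_all
  simp only [h]
  rw [sum_sub_distrib, ← mul_sum, sum_boole]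
  simp

theorem aux_arith (m M : ℕ) (hm : 4 ≤ m)
    (h : ((2 ^ (2 * m) : ℕ) - 2 * ((M * (2 * (2 ^ m - 1)) : ℕ) : ℤ) : ℤ).natAbs = 2 ^ m) :
    4 ∣ M := by
  obtain ⟨v, rfl⟩ := Nat.exists_eq_add_of_le hm
  have hle : 1 ≤ 2 ^ (4 + v) := Nat.one_le_two_pow
  have hq : ((2 : ℤ) ^ (4 + v)) = 16 * 2 ^ v := by rw [pow_add]; norm_num
  rw [mul_comm 2 (4 + v), pow_mul] at h
  have h2 := Int.natAbs_eq_iff.1 h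
  push_cast [Nat.cast_sub hle] at h2
  rw [hq] at h2
  generalize (2 : ℤ) ^ v = u at h2
  have : (4 : ℤ) ∣ M := by
    rcases h2 with h2 | h2
    · exact ⟨4 * u * M - 16 * u ^ 2 + u, by linarith⟩
    · exact ⟨4 * u * M - 16 * u ^ 2 - u, by linarith⟩
  exact_mod_cast this

/-- For odd `k ≥ 3`, `m = 3k` and nonzero `a ∈ E = F_{2^{2m}}`, the function
`f(x) = Tr^{2m}_k(a x^(2^m - 1))` from `E` to `F_{2^k} ⊆ E` is not bent. -/
theorem stmt1 {E : Type*} [Field E] [Fintype E] [DecidableEq E] (k m : ℕ)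
    (hodd : Odd k) (hk : 3 ≤ k) (hm : m = 3 * k)
    (hcard : Fintype.card E = 2 ^ (2 * m)) (a : E) (ha : a ≠ 0) :
    ¬ IsBent (2 * m) k (fun x => relTrace k (2 * m) (a * x ^ (2 ^ m - 1))) := by
  classical
  intro hbent
  have hfact : Fact (Nat.Prime 2) := ⟨Nat.prime_two⟩
  have hchar : CharP E 2 := charP_of_card_eq_prime_pow hcard
  have hmodd : Odd m := hm ▸ Odd.mul (by decide) hodd
  have h2m : 2 ^ (2 * m) = (2 ^ m) ^ 2 := by rw [mul_comm, pow_mul]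
  have hd : 2 ^ m - 1 ∣ Fintype.card E - 1 := by
    rw [hcard]
    exact Nat.pow_sub_one_dvd_pow_sub_one 2 (Dvd.intro_left 2 rfl)
  have hdk : 2 ^ k - 1 ∣ Fintype.card E - 1 := by
    rw [hcard]
    exact Nat.pow_sub_one_dvd_pow_sub_one 2 ⟨6, by omega⟩
  have h3 : 3 ∣ Fintype.card E - 1 := by
    rw [hcard]
    exact Nat.pow_sub_one_dvd_pow_sub_one 2 (Dvd.intro m rfl)
  have hqq : ∀ x : E, (x ^ 2 ^ m) ^ 2 ^ m = x := by
    intro x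
    rw [← pow_mul, ← pow_add, ← two_mul, ← hcard, FiniteField.pow_card]
  have hle : 2 ^ 1 ≤ 2 ^ m := Nat.pow_le_pow_right (by norm_num) (by omega)
  -- polar decomposition of `a`
  obtain ⟨s, hs⟩ : ∃ s : E, s ^ 2 = a := by
    refine ⟨a ^ 2 ^ (2 * m - 1), ?_⟩
    rw [← pow_mul, ← pow_succ, Nat.sub_add_cancel (by omega), ← hcard, FiniteField.pow_card]
  have hs0 : s ≠ 0 := by
    rintro rfl
    exact ha (by rw [← hs]; simp)
  have hv0 : s ^ 2 ^ m ≠ 0 := pow_ne_zero _ hs0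
  have hαv : s * s ^ 2 ^ m * (s ^ 2 ^ m) ^ (2 ^ m - 1) = a := by
    rw [mul_assoc, ← pow_succ', Nat.sub_add_cancel (by omega), hqq, ← hs, sq]
  have hαq : (s * s ^ 2 ^ m) ^ 2 ^ m = s * s ^ 2 ^ m := by
    rw [mul_pow, hqq, mul_comm]
  have hα0 : s * s ^ 2 ^ m ≠ 0 := mul_ne_zero hs0 hv0
  generalize s * s ^ 2 ^ m = α at hαv hαq hα0
  generalize s ^ 2 ^ m = v at hαv hv0
  obtain ⟨w2, wπ, wker⟩ := aux_witt (E := E)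
  refine aux_final (R := WittVector 2 E) w2 (WittVector.teichmuller 2) WittVector.constantCoeff wπ
    k hk hodd hdk α hα0 (hm ▸ hαq) ?_
  intro b hb
  have hk1 : 2 ^ 1 ≤ 2 ^ k := Nat.pow_le_pow_right (by norm_num) (by omega)
  have hb0 : b ≠ 0 := by
    rintro rfl
    rw [zero_pow (by omega)] at hb
    exact zero_ne_one hb
  have hbk : b ^ 2 ^ k = b := by
    conv_lhs => rw [← Nat.sub_add_cancel (show 1 ≤ 2 ^ k by omega), pow_succ, hb, one_mul]
  have hbm : b ^ 2 ^ m = b := by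
    have := aux_frob_fix k b hbk 3 0
    rwa [add_zero, pow_zero, pow_one, ← hm] at this
  have hcq : (α * b) ^ 2 ^ m = α * b := by rw [mul_pow, hαq, hbm]
  rw [← hm]
  apply aux_M (WittVector.teichmuller 2) WittVector.constantCoeff wπ wker m (by omega) hd _ hcq
  have hw := hbent 0 b hbk hb0
  unfold walsh at hw
  simp only [zero_mul, aux_tr_zero, add_zero, aux_rel k m hk hm b _ hbk] at hw
  rw [aux_sgn, Nat.mul_div_cancel_left _ (by norm_num), hcard] at hw
  have hbij : Finset.card {x : E | absTrace (2 * m) (b * (a * x ^ (2 ^ m - 1))) ≠ 0}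
      = Finset.card {x : E | absTrace (2 * m) (α * b * x ^ (2 ^ m - 1)) ≠ 0} := by
    have hx : ∀ x : E, b * (a * x ^ (2 ^ m - 1)) = α * b * (v * x) ^ (2 ^ m - 1) := by
      intro x
      rw [← hαv, mul_pow]; ring
    refine Finset.card_bij' (fun x _ => v * x) (fun x _ => v⁻¹ * x) ?_ ?_ ?_ ?_
    · intro x h
      simp only [Finset.mem_filter, Finset.mem_univ, true_and] at h ⊢
      rwa [← hx]
    · intro x h
      simp only [Finset.mem_filter, Finset.mem_univ, true_and] at h ⊢
      rwa [hx, mul_inv_cancel_left₀ hv0]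
    · intro x _
      exact inv_mul_cancel_left₀ hv0 x
    · intro x _
      exact mul_inv_cancel_left₀ hv0 x
  rw [hbij, aux_red m hmodd hcard h3 hd _ hcq] at hw
  exact aux_arith m _ (by omega) hw
end

section
/- Let k be an odd integer with k ≥ 3, set m = 3k, and let a be a nonzero element of F_{2^m}. Then there exists an element u in the coset a F_{2^k}^* = {a z : z ∈ F_{2^k}^*} such that the Kloosterman sum K_{2^m}(u) is nonzero. -/
section helpers

variable {F : Type*} [Field F]

/-! ### The absolute trace -/

lemma absTrace_add [CharP F 2] (m : ℕ) (x y : F) :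
    absTrace m (x + y) = absTrace m x + absTrace m y := by
  simp only [absTrace, add_pow_char_pow, Finset.sum_add_distrib]

lemma absTrace_sq [CharP F 2] (m : ℕ) (x : F) : absTrace m (x ^ 2) = (absTrace m x) ^ 2 := by
  simp only [absTrace, sum_pow_char]
  refine Finset.sum_congr rfl fun i _ => ?_
  rw [← pow_mul, ← pow_mul, mul_comm]

lemma absTrace_sq_add [CharP F 2] (m : ℕ) (x : F) :
    absTrace m (x ^ 2 + x) = x ^ (2 ^ m) + x := by
  induction m with
  | zero => simp [absTrace, CharTwo.add_self_eq_zero]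
  | succ n ih =>
    have h : absTrace (n + 1) (x ^ 2 + x) = absTrace n (x ^ 2 + x) + (x ^ 2 + x) ^ (2 ^ n) := by
      simp [absTrace, Finset.sum_range_succ]
    rw [h, ih, add_pow_char_pow, ← pow_mul, ← pow_succ']
    linear_combination (x ^ 2 ^ n) * CharTwo.two_eq_zero (R := F)

lemma absTrace_sq_add_eq_zero [CharP F 2] (m : ℕ) (hF : ∀ x : F, x ^ (2 ^ m) = x) (x : F) :
    absTrace m (x ^ 2 + x) = 0 := by
  rw [absTrace_sq_add, hF, CharTwo.add_self_eq_zero]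

lemma absTrace_sq' [CharP F 2] (m : ℕ) (hF : ∀ x : F, x ^ (2 ^ m) = x) (x : F) :
    absTrace m (x ^ 2) = absTrace m x := by
  have := absTrace_sq_add_eq_zero m hF x
  rw [absTrace_add] at this
  exact CharTwo.add_eq_zero.mp this

lemma absTrace_one [CharP F 2] (m : ℕ) (hm : Odd m) : absTrace m (1 : F) = 1 := by
  obtain ⟨n, rfl⟩ := hm
  simp [absTrace, CharTwo.two_eq_zero]

lemma half_trace [CharP F 2] (n : ℕ) (d : F) :
    (∑ i ∈ Finset.range (n + 1), d ^ (2 ^ (2 * i))) ^ 2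
      + ∑ i ∈ Finset.range (n + 1), d ^ (2 ^ (2 * i)) = absTrace (2 * n + 2) d := by
  induction n with
  | zero => simp [absTrace, Finset.sum_range_succ]; ring
  | succ n ih =>
    rw [Finset.sum_range_succ, CharTwo.add_sq]
    have h : absTrace (2 * (n + 1) + 2) d = absTrace (2 * n + 2) d + d ^ (2 ^ (2 * (n + 1)))
        + (d ^ (2 ^ (2 * (n + 1)))) ^ 2 := by
      simp only [absTrace]
      rw [Finset.sum_range_succ, show 2 * (n + 1) + 1 = (2 * n + 2) + 1 by ring,
        Finset.sum_range_succ, ← pow_mul, ← pow_succ]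
      rfl
    rw [h, ← ih]; ring

lemma exists_artin [CharP F 2] (m : ℕ) (hm : Odd m) (hF : ∀ x : F, x ^ (2 ^ m) = x) (d : F)
    (hd : absTrace m d = 0) : ∃ t : F, t ^ 2 + t = d := by
  obtain ⟨n, rfl⟩ := hm
  refine ⟨_, (half_trace n d).trans ?_⟩
  have : absTrace (2 * n + 2) d = absTrace (2 * n + 1) d + d ^ (2 ^ (2 * n + 1)) := by
    simp [absTrace, Finset.sum_range_succ]
  rw [this, hd, hF, zero_add]

lemma card_artin [Fintype F] [DecidableEq F] [CharP F 2] (m : ℕ) (hm : Odd m)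
    (hF : ∀ x : F, x ^ (2 ^ m) = x) (d : F) :
    ((Finset.univ.filter fun t : F => t ^ 2 + t = d).card : ℤ) = 1 + sgn (absTrace m d) := by
  by_cases hd : absTrace m d = 0
  · obtain ⟨t, ht⟩ := exists_artin m hm hF d hd
    have : (Finset.univ.filter fun t : F => t ^ 2 + t = d) = {t, t + 1} := by
      ext s
      simp only [Finset.mem_filter, Finset.mem_univ, true_and, Finset.mem_insert,
        Finset.mem_singleton]
      constructor
      · intro hs
        have h : (s - t) * (s - (t + 1)) = 0 := by
          linear_combination hs - ht + (t ^ 2 + t - s - s * t) * CharTwo.two_eq_zero (R := F)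
        rcases mul_eq_zero.mp h with h | h
        · left; exact sub_eq_zero.mp h
        · right; exact sub_eq_zero.mp h
      · rintro (rfl | rfl)
        · exact ht
        · linear_combination ht + (t + 1) * CharTwo.two_eq_zero (R := F)
    rw [this, Finset.card_pair (by simp), sgn, if_pos hd]; norm_num
  · have : (Finset.univ.filter fun t : F => t ^ 2 + t = d) = ∅ := by
      ext s
      simp only [Finset.mem_filter, Finset.mem_univ, true_and, Finset.notMem_empty, iff_false]
      rintro rfl
      exact hd (absTrace_sq_add_eq_zero m hF s)
    rw [this, sgn, if_neg hd]; simp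

/-! ### A group lemma -/

lemma exists_eighth {G : Type*} [AddCommGroup G] [Fintype G] (m : ℕ) (hm : 4 ≤ m)
    (hG : Fintype.card G = 2 ^ m) (T : G) (hT : ∀ P : G, P + P = 0 → P = 0 ∨ P = T) :
    ∃ P Q R : G, R + R = T ∧ Q + Q = R ∧ P + P = Q := by
  classical
  have key : ∀ s : Finset G, s.card ≤ 2 * (s.image fun x => x + x).card := by
    intro s
    refine Finset.card_le_mul_card_image s 2 ?_
    intro b hb
    obtain ⟨x, hx, rfl⟩ := Finset.mem_image.mp hb
    refine (Finset.card_le_card (t := {x, x + T}) ?_).trans Finset.card_le_two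
    intro y hy
    have hy := (Finset.mem_filter.mp hy).2
    have : (y - x) + (y - x) = 0 := by
      rw [show (y - x) + (y - x) = (y + y) - (x + x) by abel, hy, sub_self]
    rcases hT _ this with h | h
    · simp [sub_eq_zero.mp h]
    · simp [← h]
  have h8 : ∃ P : G, 8 • P ≠ 0 := by
    by_contra! hcon
    have h1 := key Finset.univ
    have h2 := key (Finset.univ.image fun x : G => x + x)
    have h3 := key ((Finset.univ.image fun x : G => x + x).image fun x : G => x + x)
    have h4 : (((Finset.univ.image fun x : G => x + x).image fun x : G => x + x).image
        fun x : G => x + x) ⊆ {0} := by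
      intro y hy
      simp only [Finset.mem_image, Finset.mem_univ, true_and] at hy
      obtain ⟨_, ⟨_, ⟨x, rfl⟩, rfl⟩, rfl⟩ := hy
      rw [Finset.mem_singleton, ← hcon x]; abel
    have h5 := Finset.card_le_card h4
    have h6 : 2 ^ 4 ≤ 2 ^ m := Nat.pow_le_pow_right (by norm_num) hm
    rw [Finset.card_univ, hG] at h1
    rw [Finset.card_singleton] at h5
    omega
  obtain ⟨P, hP⟩ := h8
  have hex : ∃ j : ℕ, (2 ^ j) • (8 • P) = 0 := ⟨m, by
    rw [← hG]; exact card_nsmul_eq_zero⟩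
  classical
  obtain ⟨j, hj, hmin⟩ : ∃ j : ℕ, (2 ^ j) • (8 • P) = 0 ∧ ∀ i < j, (2 ^ i) • (8 • P) ≠ 0 :=
    ⟨Nat.find hex, Nat.find_spec hex, fun i hi => Nat.find_min hex hi⟩
  obtain _ | i := j
  · simp at hj; exact absurd hj hP
  have h1 := hmin i (Nat.lt_succ_self i)
  have h2 : (2 ^ i) • (8 • P) = T := by
    refine (hT _ ?_).resolve_left h1
    rw [← hj, ← two_nsmul, smul_smul, pow_succ']
  refine ⟨2 ^ i • P, _, _, ?_, rfl, rfl⟩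
  rw [← h2, smul_comm]; abel

/-! ### The elliptic curve -/

/-- The curve `y² + xy = x³ + A`. -/
def kCurve (A : F) : WeierstrassCurve.Affine F :=
  ({ a₁ := 1, a₂ := 0, a₃ := 0, a₄ := 0, a₆ := A } : WeierstrassCurve F)

lemma kCurve_equation (A x y : F) :
    (kCurve A).Equation x y ↔ y ^ 2 + x * y = x ^ 3 + A := by
  rw [WeierstrassCurve.Affine.equation_iff]
  simp [kCurve]

lemma kCurve_nonsingular [CharP F 2] (A x y : F) (hA : A ≠ 0) :
    (kCurve A).Nonsingular x y ↔ y ^ 2 + x * y = x ^ 3 + A := by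
  rw [← kCurve_equation]
  refine (WeierstrassCurve.Affine.equation_iff_nonsingular_of_Δ_ne_zero ?_).symm
  have : (kCurve A).Δ = A := by
    simp only [kCurve, WeierstrassCurve.Δ, WeierstrassCurve.b₂, WeierstrassCurve.b₄,
      WeierstrassCurve.b₆, WeierstrassCurve.b₈]
    linear_combination (-A - 216 * A ^ 2) * CharTwo.two_eq_zero (R := F)
  rw [this]; exact hA

lemma kCurve_double [CharP F 2] [DecidableEq F] (A : F) (P : (kCurve A).Point) (x' y' : F)
    (h' : (kCurve A).Nonsingular x' y') (hP : P + P = .some x' y' h') :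
    ∃ x y h, P = .some x y h ∧ x ≠ 0 ∧ x' * x ^ 2 = x ^ 4 + A := by
  obtain _ | ⟨x, y, h⟩ := P
  · exact absurd ((add_zero (0 : (kCurve A).Point)).symm.trans hP) (by
      exact (WeierstrassCurve.Affine.Point.some_ne_zero h').symm)
  refine ⟨x, y, h, rfl, ?_⟩
  have hneg : (kCurve A).negY x y = y + x := by
    simp only [kCurve, WeierstrassCurve.Affine.negY]
    linear_combination (- x - y) * CharTwo.two_eq_zero (R := F)
  have hy : y ≠ (kCurve A).negY x y := by
    intro hy
    rw [WeierstrassCurve.Affine.Point.add_self_of_Y_eq hy] at hP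
    exact (WeierstrassCurve.Affine.Point.some_ne_zero h').symm hP
  have hx : x ≠ 0 := by
    rintro rfl
    rw [hneg] at hy; simp at hy
  refine ⟨hx, ?_⟩
  rw [WeierstrassCurve.Affine.Point.add_self_of_Y_ne hy] at hP
  injection hP with h1 h2
  have heq := (kCurve_equation A x y).mp h.1
  rw [WeierstrassCurve.Affine.slope_of_Y_ne rfl hy, hneg] at h1
  have e : y - (y + x) = -x := by ring
  rw [e] at h1
  simp only [WeierstrassCurve.Affine.addX, kCurve] at h1
  rw [← h1]
  field_simp
  linear_combination heq + (4 * x ^ 4 - 2 * x ^ 3 - 3 * x ^ 2 * y) * CharTwo.two_eq_zero (R := F)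

lemma kCurve_two_torsion [CharP F 2] [DecidableEq F] (a : F)
    (h0 : (kCurve (a ^ 2)).Nonsingular 0 a) (P : (kCurve (a ^ 2)).Point) (hP : P + P = 0) :
    P = 0 ∨ P = .some 0 a h0 := by
  obtain _ | ⟨x, y, h⟩ := P
  · left; rfl
  right
  have hneg : (kCurve (a ^ 2)).negY x y = y + x := by
    simp only [kCurve, WeierstrassCurve.Affine.negY]
    linear_combination (- x - y) * CharTwo.two_eq_zero (R := F)
  by_cases hy : y = (kCurve (a ^ 2)).negY x y
  · rw [hneg] at hy
    have hx : x = 0 := by simpa using hy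
    subst hx
    have heq := (kCurve_equation _ _ y).mp h.1
    have : y = a := by
      refine CharTwo.sq_injective (R := F) ?_
      simpa using heq
    subst this
    rfl
  · rw [WeierstrassCurve.Affine.Point.add_self_of_Y_ne hy] at hP
    exact absurd hP (WeierstrassCurve.Affine.Point.some_ne_zero _)

lemma kCurve_card [Fintype F] [DecidableEq F] [CharP F 2] (m : ℕ) (hm : Odd m)
    (hF : ∀ x : F, x ^ (2 ^ m) = x) (hcard : Fintype.card F = 2 ^ m) (a : F) :
    ((Finset.univ.filter fun p : F × F => p.2 ^ 2 + p.1 * p.2 = p.1 ^ 3 + a ^ 2).card : ℤ) + 1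
      = 2 ^ m + kloosterman m a := by
  have h1 : ((Finset.univ.filter fun p : F × F => p.2 ^ 2 + p.1 * p.2 = p.1 ^ 3 + a ^ 2).card : ℤ)
      = ∑ x : F, ((Finset.univ.filter fun y : F => y ^ 2 + x * y = x ^ 3 + a ^ 2).card : ℤ) := by
    simp only [Finset.card_filter]
    push_cast
    rw [Fintype.sum_prod_type]
  have h0 : (Finset.univ.filter fun y : F => y ^ 2 + 0 * y = 0 ^ 3 + a ^ 2) = {a} := by
    ext y
    simp only [Finset.mem_filter, Finset.mem_univ, true_and, Finset.mem_singleton]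
    constructor
    · intro h
      refine CharTwo.sq_injective (R := F) ?_
      simpa using h
    · rintro rfl; simp
  have hx : ∀ x : F, x ≠ 0 →
      ((Finset.univ.filter fun y : F => y ^ 2 + x * y = x ^ 3 + a ^ 2).card : ℤ)
        = 1 + sgn (absTrace m (x + a * x⁻¹)) := by
    intro x hx
    have e : absTrace m (x + a * x⁻¹) = absTrace m (x + (a * x⁻¹) ^ 2) := by
      rw [absTrace_add, absTrace_add, absTrace_sq' m hF]
    rw [e, ← card_artin m hm hF]
    congr 1
    refine Finset.card_bij' (fun y _ => y * x⁻¹) (fun t _ => t * x) ?_ ?_ ?_ ?_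
    · intro y hy
      simp only [Finset.mem_filter, Finset.mem_univ, true_and] at hy ⊢
      field_simp
      linear_combination hy
    · intro t ht
      simp only [Finset.mem_filter, Finset.mem_univ, true_and] at ht ⊢
      field_simp at ht
      linear_combination ht
    · intro y _; field_simp
    · intro t _; field_simp
  have hsplit : ∀ f : F → ℤ, ∑ x : F, f x = f 0 + ∑ x ∈ Finset.univ.filter (fun x : F => x ≠ 0), f x := by
    intro f
    rw [← Finset.sum_filter_add_sum_filter_not Finset.univ (fun x : F => x = 0)]
    congr 1
    rw [Finset.filter_eq' Finset.univ (0 : F)]; simp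
  have hinv : ∑ x ∈ Finset.univ.filter (fun x : F => x ≠ 0), sgn (absTrace m (x + a * x⁻¹))
      = ∑ x ∈ Finset.univ.filter (fun x : F => x ≠ 0), sgn (absTrace m (x⁻¹ + a * x)) := by
    refine Finset.sum_bij' (fun x _ => x⁻¹) (fun x _ => x⁻¹) ?_ ?_ ?_ ?_ ?_ <;> simp
  have hone := hsplit (fun _ => 1)
  simp only [Finset.sum_const, Finset.card_univ, hcard, nsmul_eq_mul, mul_one] at hone
  push_cast at hone
  rw [h1, hsplit, h0, Finset.sum_congr rfl (fun x hx' => hx x (by simpa using hx')),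
    Finset.sum_add_distrib, hinv, kloosterman]
  simp only [Finset.sum_const, nsmul_eq_mul, mul_one, Finset.card_singleton, hone]
  push_cast
  ring

/-- If `K(c⁴) = 0` then `c = v² + v` with `Tr(v³ + v) = 0`. -/
lemma kloosterman_zero [Fintype F] [DecidableEq F] [CharP F 2] (m : ℕ) (hm : Odd m) (hm4 : 4 ≤ m)
    (hcard : Fintype.card F = 2 ^ m) (c : F) (hc : c ≠ 0)
    (hK : kloosterman m (c ^ 4) = 0) :
    ∃ v : F, v ^ 2 + v = c ∧ absTrace m (v ^ 3 + v) = 0 := by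
  classical
  have hF : ∀ x : F, x ^ (2 ^ m) = x := fun x => by rw [← hcard]; exact FiniteField.pow_card x
  have hsurj : ∀ x : F, ∃ y, y ^ 2 = x := by
    have := Finite.surjective_of_injective (CharTwo.sq_injective (R := F))
    exact this
  have ha : (c ^ 4) ^ 2 ≠ 0 := by positivity
  have h0 : (kCurve ((c ^ 4) ^ 2)).Nonsingular 0 (c ^ 4) := by
    rw [kCurve_nonsingular _ _ _ ha]; ring
  let e : (kCurve ((c ^ 4) ^ 2)).Point ≃ Option {p : F × F // p.2 ^ 2 + p.1 * p.2 = p.1 ^ 3 + (c ^ 4) ^ 2} :=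
    (WeierstrassCurve.Affine.nonsingularPointEquiv _).trans
      (Equiv.optionCongr (Equiv.subtypeEquivRight fun p => kCurve_nonsingular _ _ _ ha))
  let _ : Fintype (kCurve ((c ^ 4) ^ 2)).Point := Fintype.ofEquiv _ e.symm
  have hG : Fintype.card (kCurve ((c ^ 4) ^ 2)).Point = 2 ^ m := by
    rw [Fintype.card_congr e, Fintype.card_option, Fintype.card_subtype]
    have := kCurve_card m hm hF hcard (c ^ 4)
    rw [hK, add_zero] at this
    exact_mod_cast this
  obtain ⟨P, Q, R, hR, hQ, hP⟩ := exists_eighth m hm4 hG (.some 0 (c ^ 4) h0)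
    (kCurve_two_torsion (c ^ 4) h0)
  obtain ⟨x1, y1, n1, rfl, hx1, e1⟩ := kCurve_double _ _ _ _ _ hR
  obtain ⟨x2, y2, n2, rfl, hx2, e2⟩ := kCurve_double _ _ _ _ _ hQ
  obtain ⟨x3, y3, n3, rfl, hx3, e3⟩ := kCurve_double _ _ _ _ _ hP
  have two := CharTwo.two_eq_zero (R := F)
  have inj : ∀ {x y : F}, x ^ 2 = y ^ 2 → x = y := fun h => CharTwo.sq_injective (R := F) h
  have f1 : x1 = c ^ 2 := by
    apply inj; apply inj
    linear_combination -e1 + c ^ 8 * -two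
  subst f1
  have f2 : c * x2 = x2 ^ 2 + c ^ 4 := by
    apply inj
    linear_combination e2 - x2 ^ 2 * c ^ 4 * two
  obtain ⟨v, hv⟩ := hsurj (x2 / c)
  have hx2' : x2 = c * v ^ 2 := by rw [hv]; field_simp
  subst hx2'
  have hvc : v ^ 2 + v = c := by
    apply inj
    have h : c ^ 2 * ((v ^ 2 + v) ^ 2 - c ^ 2) = 0 := by
      linear_combination f2 + (c ^ 2 * v ^ 4 + c ^ 2 * v ^ 3) * two
    rcases mul_eq_zero.mp h with h | h
    · exact absurd h (by positivity)
    · exact sub_eq_zero.mp h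
  refine ⟨v, hvc, ?_⟩
  have hv0 : v ≠ 0 := by
    rintro rfl; simp at hx2
  obtain ⟨r, hr⟩ := hsurj (c * v ^ 2)
  have hr0 : r ≠ 0 := by
    rintro rfl; apply hx2; rw [← hr]; simp
  have f3 : r * x3 = x3 ^ 2 + c ^ 4 := by
    apply inj
    rw [← hr] at e3
    linear_combination e3 - x3 ^ 2 * c ^ 4 * two
  have f4 : (x3 / r) ^ 2 + x3 / r = v * (v + 1) ^ 3 := by
    have : (x3 / r) ^ 2 + x3 / r = c ^ 4 / (c * v ^ 2) := by
      rw [← hr]; field_simp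
      linear_combination f3 + (x3 ^ 2) * two
    rw [this]
    have hc' : c = v * (v + 1) := by rw [← hvc]; ring
    field_simp
    rw [hc']; ring
  have h := absTrace_sq_add_eq_zero m hF (x3 / r)
  rw [f4, show v * (v + 1) ^ 3 = ((v ^ 2) ^ 2 + v ^ 2) + (v ^ 3 + v) by
    linear_combination (v ^ 3 + v ^ 2) * two, absTrace_add,
    absTrace_sq_add_eq_zero m hF, zero_add] at h
  exact h

/-! ### Relative trace -/

lemma absTrace_rel [CharP F 2] (k : ℕ) (x : F) :
    absTrace (3 * k) x = absTrace k (x + x ^ 2 ^ k + (x ^ 2 ^ k) ^ 2 ^ k) := by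
  have h : ∀ n l, absTrace (n + l) x = absTrace n x + absTrace l (x ^ 2 ^ n) := by
    intro n l
    simp only [absTrace, Finset.sum_range_add]
    congr 1
    refine Finset.sum_congr rfl fun i _ => ?_
    rw [← pow_mul, pow_add]
  rw [show 3 * k = k + k + k by ring, h, h, absTrace_add, absTrace_add, ← pow_mul, ← pow_add]

end helpers

theorem stmt2 {F : Type*} [Field F] [Fintype F] [DecidableEq F] (k m : ℕ)
    (hodd : Odd k) (hk : 3 ≤ k) (hm : m = 3 * k)
    (hcard : Fintype.card F = 2 ^ m) (a : F) (ha : a ≠ 0) :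
    ∃ z : F, z ^ (2 ^ k) = z ∧ z ≠ 0 ∧ kloosterman m (a * z) ≠ 0 := by
  have : Fact (Nat.Prime 2) := ⟨Nat.prime_two⟩
  have : CharP F 2 := charP_of_card_eq_prime_pow hcard
  by_contra! hcon
  have hmo : Odd m := by rw [hm]; exact Odd.mul (by decide) hodd
  have hF : ∀ x : F, x ^ (2 ^ m) = x := fun x => by rw [← hcard]; exact FiniteField.pow_card x
  have hF3 : ∀ x : F, ((x ^ 2 ^ k) ^ 2 ^ k) ^ 2 ^ k = x := by
    intro x
    rw [← pow_mul, ← pow_mul, ← pow_add, ← pow_add, ← show m = k + (k + k) by omega]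
    exact hF x
  have two := CharTwo.two_eq_zero (R := F)
  have inj : ∀ {x y : F}, x ^ 2 = y ^ 2 → x = y := fun h => CharTwo.sq_injective (R := F) h
  have hsurj : ∀ x : F, ∃ y, y ^ 2 = x :=
    Finite.surjective_of_injective (CharTwo.sq_injective (R := F))
  have hq : ∀ x y : F, (x + y) ^ 2 ^ k = x ^ 2 ^ k + y ^ 2 ^ k := fun x y => add_pow_char_pow ..
  obtain ⟨b, hb⟩ := hsurj a
  obtain ⟨α, rfl⟩ := hsurj b
  have hα : α ≠ 0 := by rintro rfl; simp at hb; exact ha hb.symm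
  have key : ∀ y : F, y ^ 2 ^ k = y → y ≠ 0 →
      ∃ v : F, v ^ 2 + v = α * y ∧ absTrace m (v ^ 3 + v) = 0 := by
    intro y hy hy0
    refine kloosterman_zero m hmo (by omega) hcard _ (mul_ne_zero hα hy0) ?_
    have := hcon (y ^ 4) (by rw [← pow_mul, mul_comm, pow_mul, hy]) (pow_ne_zero _ hy0)
    rw [← this, ← hb]; congr 1; ring
  -- names for conjugates
  obtain ⟨p, hp⟩ : ∃ p, p = α ^ 2 ^ k := ⟨_, rfl⟩
  obtain ⟨r, hr⟩ : ∃ r, r = p ^ 2 ^ k := ⟨_, rfl⟩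
  have hrr : r ^ 2 ^ k = α := by rw [hr, hp]; exact hF3 α
  -- the relative trace vanishes
  have hT : α + p + r = 0 := by
    by_contra hT
    have hinv : (α + p + r)⁻¹ ^ 2 ^ k = (α + p + r)⁻¹ := by
      rw [inv_pow, hq, hq, ← hp, ← hr, hrr]; congr 1; ring
    obtain ⟨v, hv, -⟩ := key _ hinv (inv_ne_zero hT)
    have h := absTrace_sq_add_eq_zero m hF v
    rw [hv, hm, absTrace_rel, mul_pow, hinv, mul_pow, hinv, ← hp, ← hr, ← add_mul, ← add_mul,
      mul_inv_cancel₀ hT, absTrace_one k hodd] at h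
    exact one_ne_zero h
  -- the second elementary symmetric function vanishes
  have hB : α * p + α * r + p * r = 0 := by
    by_contra hB
    obtain ⟨y, hy⟩ := hsurj (α * p + α * r + p * r)⁻¹
    have hy0 : y ≠ 0 := by
      rintro rfl
      exact inv_ne_zero hB (by rw [← hy]; simp)
    have hyk : y ^ 2 ^ k = y := by
      apply inj
      rw [← pow_mul, mul_comm, pow_mul, hy, inv_pow, hq, hq, mul_pow, mul_pow, mul_pow,
        ← hp, ← hr, hrr]
      congr 1; ring
    obtain ⟨v, hv, hv3⟩ := key y hyk hy0
    obtain ⟨v1, hv1⟩ : ∃ v1, v1 = v ^ 2 ^ k := ⟨_, rfl⟩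
    obtain ⟨v2, hv2⟩ : ∃ v2, v2 = v1 ^ 2 ^ k := ⟨_, rfl⟩
    have g1 : v1 ^ 2 + v1 = p * y := by
      rw [hv1, ← pow_mul, mul_comm, pow_mul, ← hq, hv, mul_pow, ← hp, hyk]
    have g2 : v2 ^ 2 + v2 = r * y := by
      rw [hv2, ← pow_mul, mul_comm, pow_mul, ← hq, g1, mul_pow, ← hr, hyk]
    have hv3' : v2 ^ 2 ^ k = v := by rw [hv2, hv1]; exact hF3 v
    have hpow : ∀ x : F, ∀ n, (x ^ n) ^ 2 ^ k = (x ^ 2 ^ k) ^ n := by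
      intro x n; rw [← pow_mul, mul_comm, pow_mul]
    have hu : (v + v1 + v2) ^ 2 + (v + v1 + v2) = 0 := by
      linear_combination hv + g1 + g2 + y * hT + (v * v1 + v * v2 + v1 * v2) * two
    rw [hm, absTrace_rel] at hv3
    simp only [hq, hpow, ← hv1, ← hv2] at hv3
    -- E = e2(v), it lies in the small field
    have hE : (v * v1 + v * v2 + v1 * v2) ^ 2 ^ k = v * v1 + v * v2 + v1 * v2 := by
      simp only [hq, mul_pow, ← hv1, ← hv2, hv3']; ring
    have hEt : absTrace k ((v * v1 + v * v2 + v1 * v2) ^ 2 + (v * v1 + v * v2 + v1 * v2)) = 0 := by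
      rw [absTrace_sq_add, hE, CharTwo.add_self_eq_zero]
    have hone : (v ^ 2 + v) * (v1 ^ 2 + v1) + (v ^ 2 + v) * (v2 ^ 2 + v2)
        + (v1 ^ 2 + v1) * (v2 ^ 2 + v2) = 1 := by
      rw [hv, g1, g2]
      have : y ^ 2 * (α * p + α * r + p * r) = 1 := by rw [hy, inv_mul_cancel₀ hB]
      linear_combination this
    have hfin : absTrace k (1 : F) = 0 := by
      have hu' : (v + v1 + v2) * (v + v1 + v2 + 1) = 0 := by linear_combination hu
      have : (1 : F) = (v ^ 3 + v + (v1 ^ 3 + v1) + (v2 ^ 3 + v2))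
          + ((v * v1 + v * v2 + v1 * v2) ^ 2 + (v * v1 + v * v2 + v1 * v2)) := by
        linear_combination -hone + (v + v1 + v2 + 1) * hu' + (-(v + v1 + v2) ^ 3
          + 2 * (v + v1 + v2) * (v * v1 + v * v2 + v1 * v2) - 3 * (v * v1 * v2) - (v + v1 + v2)
          - (v + v1 + v2) * (v * v1 * v2) - (v + v1 + v2) ^ 2) * two
      rw [this, absTrace_add, hEt, hv3, add_zero]
    rw [absTrace_one k hodd] at hfin
    exact one_ne_zero hfin
  -- conclusion: a primitive cube root of unity
  have h := absTrace_sq_add_eq_zero m hF (p / α)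
  have h1 : (p / α) ^ 2 + p / α = 1 := by
    field_simp
    linear_combination hB - (α + p) * hT + (α ^ 2 - α ^ 2 + p ^ 2 + α * p) * two
  rw [h1, absTrace_one m hmo] at h
  exact one_ne_zero h
end

section
/- Let k be an even positive integer, set m = 3k, and let a be a nonzero element of F_{2^m}. If the function f : F_{2^{2m}} → F_{2^k} given by f(x) = Tr^{2m}_k(a x^{2^m - 1}) is bent, then a^{3(2^k - 1)} = 1. -/
section Helpers

variable {E : Type*} [Field E] [Fintype E] [DecidableEq E]
variable {W : Type*} [CommRing W] [IsDomain W]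

/-- Character sums over the multiplicative group. -/
lemma charSum (n : ℕ) (hcard : Fintype.card E = 2 ^ n) (τ : E →* W)
    (hinj : Function.Injective τ) (z : ℤ) :
    (∑ x : Eˣ, τ ((x ^ z : Eˣ) : E)) = if ((2 : ℤ) ^ n - 1) ∣ z then ((2 : W) ^ n - 1) else 0 := by
  have hcu : Fintype.card Eˣ = 2 ^ n - 1 := by rw [Fintype.card_units, hcard]
  have h1 : 1 ≤ 2 ^ n := Nat.one_le_two_pow
  have hcz : ((Fintype.card Eˣ : ℕ) : ℤ) = 2 ^ n - 1 := by
    rw [hcu]; push_cast [h1]; ring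
  split_ifs with h
  · have : ∀ x : Eˣ, x ^ z = 1 := by
      intro x
      obtain ⟨d, rfl⟩ := h
      rw [zpow_mul, ← hcz, zpow_natCast, pow_card_eq_one, one_zpow]
    simp only [this, Units.val_one, map_one, Finset.sum_const, Finset.card_univ, hcu, nsmul_eq_mul,
      mul_one]
    push_cast [h1]; ring
  · let f : Eˣ →* W := (τ.comp (Units.coeHom E)).comp (zpowGroupHom z)
    have hf : f ≠ 1 := by
      intro hf
      obtain ⟨g, hg⟩ := IsCyclic.exists_generator (α := Eˣ)
      have h2 : f g = 1 := by rw [hf]; rfl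
      have h3 : g ^ z = 1 := by
        apply Units.ext
        apply hinj
        simpa [f] using h2
      apply h
      rw [← hcz, ← orderOf_eq_card_of_forall_mem_zpowers hg |>.trans Nat.card_eq_fintype_card]
      exact orderOf_dvd_iff_zpow_eq_one.mpr h3
    have := sum_hom_units_eq_zero f hf
    simpa [f] using this

lemma sum_inv_invol [CharP E 2] (π : W →+* E) (hπ : ∀ w, π w = 0 → ∃ v, w = 2 * v)
    (d : Eˣ → W) (hd : ∀ x, d x⁻¹ = d x) : ∃ v, ∑ x, d x = d 1 + 2 * v := by
  have h0 : π (∑ x ∈ Finset.univ.erase (1 : Eˣ), d x) = 0 := by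
    rw [map_sum]
    refine Finset.sum_involution (fun x _ => x⁻¹) ?_ ?_ ?_ ?_
    · intro x _
      rw [hd]; exact CharTwo.add_self_eq_zero _
    · intro x hx _ h
      have h1 : x ≠ 1 := (Finset.mem_erase.mp hx).1
      apply h1
      have h2 : x * x = 1 := by
        nth_rewrite 1 [← h]; simp
      have h3 : (x : E) * x = 1 := by rw [← Units.val_mul, h2]; rfl
      apply Units.ext
      rcases mul_self_eq_one_iff.mp h3 with h4 | h4
      · exact h4
      · rw [h4, CharTwo.neg_eq]; rfl
    · intro x hx
      simpa using hx
    · intro x hx; simp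
  obtain ⟨v, hv⟩ := hπ _ h0
  refine ⟨v, ?_⟩
  rw [← hv, Finset.add_sum_erase _ _ (Finset.mem_univ _)]

lemma nodvd1 (m i j : ℕ) (hi : i < m) (hj : j < m) :
    ¬ ((2 : ℤ) ^ (2 * m) - 1) ∣ ((2 ^ m - 1) * 2 ^ i + (2 ^ m - 1) * 2 ^ j) := by
  intro h
  have hm1 : (2 : ℤ) ^ m ≥ 2 := by
    calc (2 : ℤ) ^ m ≥ 2 ^ 1 := pow_le_pow_right₀ (by norm_num) (by omega)
      _ = 2 := by norm_num
  have h2 : ((2 : ℤ) ^ m + 1) ∣ 2 ^ i + 2 ^ j := by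
    refine (mul_dvd_mul_iff_left (a := (2 : ℤ) ^ m - 1) (by linarith)).mp ?_
    have e1 : ((2 : ℤ) ^ m - 1) * (2 ^ m + 1) = 2 ^ (2 * m) - 1 := by ring
    rw [e1, mul_add]; exact h
  have h3 := Int.le_of_dvd (by positivity) h2
  have hi' : (2 : ℤ) ^ i ≤ 2 ^ (m - 1) := pow_le_pow_right₀ (by norm_num) (by omega)
  have hj' : (2 : ℤ) ^ j ≤ 2 ^ (m - 1) := pow_le_pow_right₀ (by norm_num) (by omega)
  have : (2 : ℤ) ^ m = 2 * 2 ^ (m - 1) := by rw [← pow_succ']; congr 1; omega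
  linarith

lemma dvd2 (m i j : ℕ) (hi : i < m) (hj : j < m) :
    ((2 : ℤ) ^ (2 * m) - 1) ∣ ((2 ^ m - 1) * 2 ^ i - (2 ^ m - 1) * 2 ^ j) ↔ i = j := by
  constructor
  swap
  · rintro rfl; simp
  intro h
  have hm1 : (2 : ℤ) ^ m ≥ 2 := by
    calc (2 : ℤ) ^ m ≥ 2 ^ 1 := pow_le_pow_right₀ (by norm_num) (by omega)
      _ = 2 := by norm_num
  have h2 : ((2 : ℤ) ^ m + 1) ∣ 2 ^ i - 2 ^ j := by
    refine (mul_dvd_mul_iff_left (a := (2 : ℤ) ^ m - 1) (by linarith)).mp ?_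
    have e1 : ((2 : ℤ) ^ m - 1) * (2 ^ m + 1) = 2 ^ (2 * m) - 1 := by ring
    rw [e1, mul_sub]; exact h
  have hi' : (2 : ℤ) ^ i ≤ 2 ^ m := pow_le_pow_right₀ (by norm_num) (by omega)
  have hj' : (2 : ℤ) ^ j ≤ 2 ^ m := pow_le_pow_right₀ (by norm_num) (by omega)
  have hi0 : (0 : ℤ) < 2 ^ i := by positivity
  have hj0 : (0 : ℤ) < 2 ^ j := by positivity
  have h3 := Int.eq_zero_of_abs_lt_dvd h2 (by rw [abs_lt]; constructor <;> linarith)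
  exact Int.pow_right_injective (by norm_num : 1 < (2 : ℤ).natAbs) (by simpa using sub_eq_zero.mp h3)

lemma sum_t_sq (m : ℕ) (hcard : Fintype.card E = 2 ^ (2 * m)) (τ : E →* W)
    (hinj : Function.Injective τ) (C : ℕ → W) (e : ℕ → ℤ) (he : ∀ i, e i = (2 ^ m - 1) * 2 ^ i) :
    ∑ x : Eˣ, (∑ i ∈ Finset.range m, C i * (τ ((x ^ e i : Eˣ) : E) + τ ((x ^ (- e i) : Eˣ) : E))) ^ 2
      = 2 * (2 ^ (2 * m) - 1) * ∑ i ∈ Finset.range m, C i ^ 2 := by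
  have key : ∀ i ∈ Finset.range m, ∀ j ∈ Finset.range m,
      (∑ x : Eˣ, (C i * (τ ((x ^ e i : Eˣ) : E) + τ ((x ^ (- e i) : Eˣ) : E))) *
        (C j * (τ ((x ^ e j : Eˣ) : E) + τ ((x ^ (- e j) : Eˣ) : E))))
      = if i = j then 2 * (2 ^ (2 * m) - 1) * (C i * C j) else 0 := by
    intro i hi j hj
    have hi := Finset.mem_range.mp hi
    have hj := Finset.mem_range.mp hj
    have hx : ∀ x : Eˣ, (C i * (τ ((x ^ e i : Eˣ) : E) + τ ((x ^ (- e i) : Eˣ) : E))) *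
        (C j * (τ ((x ^ e j : Eˣ) : E) + τ ((x ^ (- e j) : Eˣ) : E)))
        = C i * C j * (τ ((x ^ (e i + e j) : Eˣ) : E) + τ ((x ^ (e i - e j) : Eˣ) : E)
          + τ ((x ^ (-(e i - e j)) : Eˣ) : E) + τ ((x ^ (-(e i + e j)) : Eˣ) : E)) := by
      intro x
      have e1 : -(e i - e j) = -e i + e j := by ring
      have e2 : -(e i + e j) = -e i + -e j := by ring
      rw [e1, e2, sub_eq_add_neg]
      simp only [zpow_add, Units.val_mul, map_mul]
      ring
    simp only [hx, ← Finset.mul_sum, Finset.sum_add_distrib]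
    simp only [charSum (2 * m) hcard τ hinj, dvd_neg]
    rw [he, he, if_neg (nodvd1 m i j hi hj)]
    simp only [dvd2 m i j hi hj]
    split_ifs <;> ring
  simp only [sq, Finset.sum_mul_sum]
  rw [Finset.sum_comm]
  rw [Finset.mul_sum]
  refine Finset.sum_congr rfl fun i hi => ?_
  rw [Finset.sum_comm, Finset.sum_congr rfl (key i hi)]
  simp [Finset.mem_range.mp hi]

lemma absTrace_01 [CharP E 2] (n : ℕ) (hcard : Fintype.card E = 2 ^ n) (y : E) :
    absTrace n y = 0 ∨ absTrace n y = 1 := by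
  have hy : y ^ (2 ^ n) = y := by rw [← hcard]; exact FiniteField.pow_card y
  have h : absTrace n y ^ 2 = absTrace n y := by
    unfold absTrace
    rw [CharTwo.sum_sq]
    have h1 := Finset.sum_range_succ (fun i => y ^ 2 ^ i) n
    have h2 := Finset.sum_range_succ' (fun i => y ^ 2 ^ i) n
    rw [h1, hy] at h2
    simp only [pow_zero, pow_one] at h2
    rw [add_right_cancel h2]
    refine Finset.sum_congr rfl fun i _ => ?_
    rw [← pow_mul, pow_succ]
  have h' : absTrace n y * (absTrace n y - 1) = 0 := by linear_combination h
  rcases mul_eq_zero.mp h' with h | h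
  · exact Or.inl h
  · exact Or.inr (sub_eq_zero.mp h)

lemma key_mod (m : ℕ) (hm : 4 ≤ m) (hcard : Fintype.card E = 2 ^ (2 * m)) [CharP E 2]
    (τ : E →* W) (π : W →+* E) (hτ : ∀ x, π (τ x) = x) (hπ : ∀ w, π w = 0 → ∃ v, w = 2 * v)
    (h2 : (2 : W) ≠ 0)
    (c : E) (hc : c ^ (2 ^ m) = c)
    (hN : 8 ∣ (Finset.univ.filter
      fun x : Eˣ => absTrace (2 * m) (c * (x : E) ^ (2 ^ m - 1)) ≠ 0).card) :
    ∃ w, ∑ i ∈ Finset.range m, τ c ^ (2 ^ i) = 4 * w := by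
  have hinj : Function.Injective τ := fun x y h => by rw [← hτ x, h, hτ]
  set T := ∑ i ∈ Finset.range m, τ c ^ (2 ^ i) with hT
  let e : ℕ → ℤ := fun i => (2 ^ m - 1) * 2 ^ i
  let C : ℕ → W := fun i => τ c ^ (2 ^ i)
  let t : Eˣ → W := fun x =>
    ∑ i ∈ Finset.range m, C i * (τ ((x ^ e i : Eˣ) : E) + τ ((x ^ (- e i) : Eˣ) : E))
  have hsum : ∑ x, t x ^ 2 = 2 * (2 ^ (2 * m) - 1) * ∑ i ∈ Finset.range m, C i ^ 2 :=
    sum_t_sq m hcard τ hinj C e (fun i => rfl)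
  have hCT : ∑ i ∈ Finset.range m, C i ^ 2 = T := by
    have h1 := Finset.sum_range_succ (fun i => τ c ^ 2 ^ i) m
    have h2 := Finset.sum_range_succ' (fun i => τ c ^ 2 ^ i) m
    rw [h1, ← map_pow τ c (2 ^ m), hc] at h2
    simp only [pow_zero, pow_one] at h2
    rw [hT, add_right_cancel h2]
    refine Finset.sum_congr rfl fun i _ => ?_
    simp only [C]
    rw [← pow_mul, pow_succ]
  have ht1 : t 1 = 2 * T := by
    simp only [t, one_zpow, Units.val_one, map_one, ← Finset.sum_mul]
    rw [hT]; ring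
  have htinv : ∀ x, t x⁻¹ = t x := by
    intro x
    refine Finset.sum_congr rfl fun i _ => ?_
    rw [inv_zpow', inv_zpow', neg_neg, add_comm]
  have hr : (((2 ^ m - 1 : ℕ)) : ℤ) = 2 ^ m - 1 := by
    push_cast [Nat.one_le_two_pow (n := m)]; ring
  have hπt : ∀ x : Eˣ, π (t x) = absTrace (2 * m) (c * (x : E) ^ (2 ^ m - 1)) := by
    intro x
    simp only [t, C, map_sum, map_mul, map_add, map_pow, hτ, absTrace]
    rw [two_mul m, Finset.sum_range_add, ← Finset.sum_add_distrib]
    refine Finset.sum_congr rfl fun i _ => ?_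
    have hx1 : (x : E) ^ (2 ^ m - 1) = ((x ^ ((2 : ℤ) ^ m - 1) : Eˣ) : E) := by
      rw [← hr, zpow_natCast, Units.val_pow_eq_pow_val]
    have hx2 : ((x ^ e i : Eˣ) : E) = ((x : E) ^ (2 ^ m - 1)) ^ (2 ^ i) := by
      rw [hx1, ← Units.val_pow_eq_pow_val, ← zpow_natCast, ← zpow_mul]
      simp [e]
    have hx3 : ((x ^ (- e i) : Eˣ) : E) = ((x : E) ^ (2 ^ m - 1)) ^ (2 ^ (m + i)) := by
      rw [hx1, ← Units.val_pow_eq_pow_val, ← zpow_natCast, ← zpow_mul]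
      congr 1
      have hone : x ^ ((2 : ℤ) ^ (m + m) - 1) = 1 := by
        have hcu : Fintype.card Eˣ = 2 ^ (2 * m) - 1 := by rw [Fintype.card_units, hcard]
        have : ((Fintype.card Eˣ : ℕ) : ℤ) = 2 ^ (m + m) - 1 := by
          rw [hcu, ← two_mul]; push_cast [Nat.one_le_two_pow (n := 2 * m)]; ring
        rw [← this, zpow_natCast, pow_card_eq_one]
      have : ((2 : ℤ) ^ m - 1) * ((2 ^ (m + i) : ℕ) : ℤ) = - e i + (2 ^ (m + m) - 1) * 2 ^ i := by
        simp only [e]; push_cast; ring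
      rw [this, zpow_add, zpow_mul, hone, one_zpow, mul_one]
    rw [hx2, hx3, mul_add, mul_pow, mul_pow]
    congr 2
    rw [pow_add, pow_mul, hc]
  let b : Eˣ → W := fun x => if absTrace (2 * m) (c * (x : E) ^ (2 ^ m - 1)) ≠ 0 then 1 else 0
  have hb : ∀ x, ∃ d, b x = t x ^ 2 + 4 * d := by
    intro x
    rcases absTrace_01 (2 * m) hcard (c * (x : E) ^ (2 ^ m - 1)) with h | h
    · obtain ⟨v, hv⟩ := hπ (t x) (by rw [hπt, h])
      refine ⟨-v ^ 2, ?_⟩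
      simp only [b, h, hv]; simp; ring
    · obtain ⟨v, hv⟩ := hπ (t x - 1) (by rw [map_sub, hπt, h]; simp)
      refine ⟨-(v + v ^ 2), ?_⟩
      have : t x = 1 + 2 * v := by linear_combination hv
      simp only [b, h, this]; simp; ring
  choose d hd using hb
  have h4 : (4 : W) ≠ 0 := by
    have : (4 : W) = 2 * 2 := by norm_num
    rw [this]; exact mul_ne_zero h2 h2
  have hbinv : ∀ x, b x⁻¹ = b x := by
    intro x
    simp only [b, ← hπt, htinv]
  have hdinv : ∀ x, d x⁻¹ = d x := by
    intro x
    have h1 := hd x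
    have h3 := hd x⁻¹
    rw [hbinv, htinv, h1] at h3
    exact (mul_left_cancel₀ h4 (add_left_cancel h3)).symm
  obtain ⟨v, hv⟩ := sum_inv_invol π hπ d hdinv
  have hb1 : b 1 = 0 := by
    simp only [b, ← hπt, ht1]
    have hπ2 : π 2 = 0 := by rw [map_ofNat]; exact CharTwo.two_eq_zero
    simp [hπ2]
  have hd1 : d 1 = - T ^ 2 := by
    have := hd 1
    rw [hb1, ht1] at this
    apply mul_left_cancel₀ h4
    linear_combination -this
  obtain ⟨N, hN⟩ := hN
  have hbsum : ∑ x, b x = 8 * (N : W) := by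
    simp only [b]
    rw [Finset.sum_boole, hN]; push_cast; ring
  have hbs2 : ∑ x, b x = ∑ x, t x ^ 2 + 4 * ∑ x, d x := by
    rw [Finset.sum_congr rfl (fun x _ => hd x), Finset.sum_add_distrib, Finset.mul_sum]
  rw [hbsum, hsum, hCT, hv, hd1] at hbs2
  obtain ⟨s, hs⟩ : ∃ s, 2 * m = s + 2 := ⟨2 * m - 2, by omega⟩
  rw [hs, pow_add] at hbs2
  have h5 : T = 2 * (2 * 2 ^ s * T - T ^ 2 + 2 * v - 2 * N) := by
    apply mul_left_cancel₀ h2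
    linear_combination hbs2
  set R := 2 * 2 ^ s * T - T ^ 2 + 2 * v - 2 * N with hR
  refine ⟨2 ^ s * T - 2 * R ^ 2 + v - N, ?_⟩
  have h6 : R = 2 * (2 ^ s * T - 2 * R ^ 2 + v - N) := by
    have h7 : T ^ 2 = 4 * R ^ 2 := by rw [h5]; ring
    linear_combination hR - h7
  linear_combination h5 + 2 * h6

/-- Linearised polynomials of small degree vanishing on the subfield have zero coefficients. -/
lemma linpoly_zero (k : ℕ) (hk : 0 < k) (hcard : Fintype.card E = 2 ^ (2 * (3 * k)))
    (β : ℕ → E) (h : ∀ b : E, b ^ (2 ^ k) = b → ∑ i ∈ Finset.range k, b ^ (2 ^ i) * β i = 0) :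
    ∀ i < k, β i = 0 := by
  classical
  let S : Finset E := Finset.univ.filter fun b => b ^ (2 ^ k) = b
  let p : Polynomial E := ∑ i ∈ Finset.range k, Polynomial.monomial (2 ^ i) (β i)
  have hk2 : 2 ≤ 2 ^ k := by
    calc 2 = 2 ^ 1 := by norm_num
      _ ≤ 2 ^ k := Nat.pow_le_pow_right (by norm_num) hk
  have hS : 2 ^ k - 1 ≤ S.card - 1 := by
    obtain ⟨g, hg⟩ := IsCyclic.exists_generator (α := Eˣ)
    have hord : orderOf g = 2 ^ (2 * (3 * k)) - 1 := by
      rw [orderOf_eq_card_of_forall_mem_zpowers hg, Nat.card_eq_fintype_card, Fintype.card_units,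
        hcard]
    have hdvd : 2 ^ k - 1 ∣ orderOf g := by
      rw [hord]
      have : 2 ^ (2 * (3 * k)) = (2 ^ k) ^ 6 := by rw [← pow_mul]; congr 1; ring
      rw [this]
      simpa using Nat.sub_dvd_pow_sub_pow (2 ^ k) 1 6
    obtain ⟨r, hr⟩ := hdvd
    have hpos : orderOf g ≠ 0 := (orderOf_pos g).ne'
    have hr0 : r ≠ 0 := by
      rintro rfl
      exact hpos (by rw [hr, mul_zero])
    have hgr : orderOf (g ^ r) = 2 ^ k - 1 := by
      rw [orderOf_pow_of_dvd hr0 ⟨2 ^ k - 1, by rw [hr]; ring⟩, hr]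
      exact Nat.mul_div_cancel _ (Nat.pos_of_ne_zero hr0)
    have hsub : (Finset.range (2 ^ k - 1)).image (fun j => (((g ^ r) ^ j : Eˣ) : E)) ⊆ S.erase 0 := by
      intro y hy
      obtain ⟨j, hj, rfl⟩ := Finset.mem_image.mp hy
      refine Finset.mem_erase.mpr ⟨Units.ne_zero _, ?_⟩
      simp only [S, Finset.mem_filter, Finset.mem_univ, true_and]
      rw [← Units.val_pow_eq_pow_val]
      congr 1
      have : (g ^ r) ^ (2 ^ k - 1) = 1 := by rw [← hgr]; exact pow_orderOf_eq_one _
      have h2 : (g ^ r) ^ (2 ^ k) = g ^ r := by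
        have h3 : 2 ^ k = (2 ^ k - 1) + 1 := by omega
        rw [h3, pow_succ, this, one_mul]
      rw [← pow_mul, mul_comm, pow_mul, h2]
    have hc := Finset.card_le_card hsub
    rw [Finset.card_image_of_injOn, Finset.card_range, Finset.card_erase_of_mem] at hc
    · exact hc
    · simp [S]
    · intro x hx y hy hxy
      simp only [Finset.coe_range, Set.mem_Iio] at hx hy
      exact pow_injOn_Iio_orderOf (by simpa [hgr] using hx) (by simpa [hgr] using hy)
        (Units.ext hxy)
  have hp : p = 0 := by
    apply Polynomial.eq_zero_of_natDegree_lt_card_of_eval_eq_zero' p S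
    · intro b hb
      simp only [p, Polynomial.eval_finsetSum, Polynomial.eval_monomial]
      rw [← h b (by simpa [S] using hb)]
      exact Finset.sum_congr rfl fun i _ => mul_comm _ _
    · refine lt_of_le_of_lt (Polynomial.natDegree_sum_le_of_forall_le (n := 2 ^ k - 1) _ _ ?_) ?_
      · intro i hi
        refine (Polynomial.natDegree_monomial_le _).trans ?_
        have : 2 ^ i < 2 ^ k := Nat.pow_lt_pow_right (by norm_num) (Finset.mem_range.mp hi)
        omega
      · omega
  intro i hi
  have := congrArg (fun q => Polynomial.coeff q (2 ^ i)) hp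
  simp only [p, Polynomial.finsetSum_coeff, Polynomial.coeff_monomial, Polynomial.coeff_zero] at this
  rw [Finset.sum_eq_single i] at this
  · simpa using this
  · intro j _ hj
    rw [if_neg]
    intro h
    exact hj (Nat.pow_right_injective (le_refl 2) h)
  · intro h; simp at h; omega

lemma sum_range_mul' {M : Type*} [AddCommMonoid M] (f : ℕ → M) (n k : ℕ) :
    ∑ l ∈ Finset.range (n * k), f l
      = ∑ i ∈ Finset.range k, ∑ j ∈ Finset.range n, f (k * j + i) := by
  rw [Finset.sum_comm]
  induction n with
  | zero => simp
  | succ n ih =>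
    rw [Nat.succ_mul, Finset.sum_range_add, ih, Finset.sum_range_succ]
    congr 1
    exact Finset.sum_congr rfl fun i _ => by rw [mul_comm]

lemma pow_sub_field (k : ℕ) (b : E) (hb : b ^ (2 ^ k) = b) (i j : ℕ) :
    b ^ (2 ^ (k * j + i)) = b ^ (2 ^ i) := by
  have h : b ^ (2 ^ (k * j)) = b := by
    induction j with
    | zero => simp
    | succ j ih => rw [Nat.mul_succ, pow_add, pow_mul, ih, hb]
  rw [pow_add, pow_mul, h]

lemma trace_trans [CharP E 2] (k n : ℕ) (hk : 0 < k) (b y : E) (hb : b ^ (2 ^ k) = b) :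
    absTrace k (b * relTrace k (n * k) y) = absTrace (n * k) (b * y) := by
  unfold absTrace relTrace
  rw [sum_range_mul', Nat.mul_div_cancel _ hk]
  refine Finset.sum_congr rfl fun i _ => ?_
  rw [mul_pow, sum_pow_char_pow, Finset.mul_sum]
  refine Finset.sum_congr rfl fun j _ => ?_
  rw [mul_pow, pow_sub_field k b hb, ← pow_mul, ← pow_add]

lemma count_dvd [CharP E 2] (k m : ℕ) (hk : 2 ≤ k) (hm : m = 3 * k)
    (hcard : Fintype.card E = 2 ^ (2 * m)) (a b : E) (hb : b ^ (2 ^ k) = b)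
    (hW : (walsh (2 * m) k (fun x => relTrace k (2 * m) (a * x ^ (2 ^ m - 1))) 0 b).natAbs
      = 2 ^ (2 * m / 2)) :
    8 ∣ (Finset.univ.filter
      fun x : Eˣ => absTrace (2 * m) (a * b * (x : E) ^ (2 ^ m - 1)) ≠ 0).card := by
  set N := (Finset.univ.filter
      fun x : Eˣ => absTrace (2 * m) (a * b * (x : E) ^ (2 ^ m - 1)) ≠ 0).card with hN
  have h0 : ∀ n, absTrace n (0 : E) = 0 := by
    intro n
    unfold absTrace
    exact Finset.sum_eq_zero fun i _ => zero_pow (by positivity)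
  have hN' : (Finset.univ.filter
      fun x : E => absTrace (2 * m) (a * b * x ^ (2 ^ m - 1)) ≠ 0).card = N := by
    rw [hN]
    symm
    refine Finset.card_bij (fun x _ => (x : E)) ?_ ?_ ?_
    · intro x hx; simpa using hx
    · intro x _ y _ h; exact Units.ext h
    · intro x hx
      have hx0 : x ≠ 0 := by
        rintro rfl
        have hr : 2 ^ m - 1 ≠ 0 := by
          have : 2 ^ 1 ≤ 2 ^ m := Nat.pow_le_pow_right (by norm_num) (by omega)
          omega
        simp [zero_pow hr, h0] at hx
      exact ⟨Units.mk0 x hx0, by simpa using hx, rfl⟩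
  have h2m : 2 * m = 6 * k := by omega
  have hw : walsh (2 * m) k (fun x => relTrace k (2 * m) (a * x ^ (2 ^ m - 1))) 0 b
      = 2 ^ (2 * m) - 2 * (N : ℤ) := by
    unfold walsh
    have : ∀ x : E, sgn (absTrace k (b * relTrace k (2 * m) (a * x ^ (2 ^ m - 1)))
        + absTrace (2 * m) (0 * x))
        = 1 - 2 * (if absTrace (2 * m) (a * b * x ^ (2 ^ m - 1)) ≠ 0 then 1 else 0) := by
      intro x
      rw [zero_mul, h0, add_zero, h2m, trace_trans k 6 (by omega) b _ hb]
      have : b * (a * x ^ (2 ^ m - 1)) = a * b * x ^ (2 ^ m - 1) := by ring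
      rw [this]
      unfold sgn
      split_ifs <;> simp_all
    rw [Finset.sum_congr rfl fun x _ => this x, Finset.sum_sub_distrib, ← Finset.mul_sum,
      Finset.sum_boole, hN']
    simp [hcard]
  rw [hw, Nat.mul_div_cancel_left _ (by norm_num : 0 < 2)] at hW
  obtain ⟨s, hs⟩ : ∃ s, m = s + 4 := ⟨m - 4, by omega⟩
  have h16 : (16 : ℤ) ∣ 2 ^ m := by rw [hs, pow_add]; exact ⟨2 ^ s, by ring⟩
  have h16' : (16 : ℤ) ∣ 2 ^ (2 * m) := by
    rw [two_mul, pow_add]; exact Dvd.dvd.mul_left h16 _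
  have hd : (16 : ℤ) ∣ 2 ^ (2 * m) - 2 * (N : ℤ) := by
    rcases Int.natAbs_eq (2 ^ (2 * m) - 2 * (N : ℤ)) with h | h
    · rw [h, hW]; exact_mod_cast h16
    · rw [h, hW, dvd_neg]; exact_mod_cast h16
  omega

lemma final_step (k m : ℕ) (hk : 2 ≤ k) (hm : m = 3 * k) [CharP E 2]
    (hcard : Fintype.card E = 2 ^ (2 * m)) (a : E) (haF : a ^ (2 ^ m) = a) (ha : a ≠ 0)
    (τ : E →* W) (π : W →+* E) (hτ : ∀ x, π (τ x) = x) (hπ : ∀ w, π w = 0 → ∃ v, w = 2 * v)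
    (h2 : (2 : W) ≠ 0)
    (hbent : IsBent (2 * m) k (fun x => relTrace k (2 * m) (a * x ^ (2 ^ m - 1)))) :
    a ^ (3 * (2 ^ k - 1)) = 1 := by
  have hπ2 : π 2 = 0 := by rw [map_ofNat]; exact CharTwo.two_eq_zero
  let A : ℕ → W := fun i => ∑ j ∈ Finset.range 3, τ a ^ (2 ^ (k * j + i))
  have hA : ∀ b : E, b ^ (2 ^ k) = b →
      ∃ w, ∑ i ∈ Finset.range k, τ b ^ (2 ^ i) * A i = 4 * w := by
    intro b hb
    by_cases hb0 : b = 0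
    · subst hb0
      have h1 : (∑ i ∈ Finset.range m, τ (0 : E) ^ (2 ^ i)) = ∑ i ∈ Finset.range m, τ 0 :=
        Finset.sum_congr rfl fun i _ => by rw [← map_pow, zero_pow (by positivity)]
      have hz : τ (0 : E) * (τ 0 - 1) = 0 := by
        have : τ (0 : E) * τ 0 = τ 0 := by rw [← map_mul, zero_mul]
        linear_combination this
      have hz0 : τ (0 : E) = 0 := by
        rcases mul_eq_zero.mp hz with h | h
        · exact h
        · have := congrArg π h
          rw [map_sub, hτ, map_one, map_zero] at this
          simp at this
      refine ⟨0, ?_⟩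
      rw [mul_zero]
      exact Finset.sum_eq_zero fun i _ => by rw [hz0, zero_pow (by positivity), zero_mul]
    have hab : (a * b) ^ (2 ^ m) = a * b := by
      rw [mul_pow, haF]
      have := pow_sub_field k b hb 0 3
      rw [hm, mul_comm 3 k]
      rw [add_zero, pow_zero, pow_one] at this
      rw [this]
    obtain ⟨w, hw⟩ := key_mod m (by omega) hcard τ π hτ hπ h2 (a * b) hab
      (count_dvd k m hk hm hcard a b hb (hbent 0 b hb hb0))
    refine ⟨w, ?_⟩
    rw [← hw, hm, sum_range_mul']
    refine Finset.sum_congr rfl fun i _ => ?_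
    rw [Finset.mul_sum]
    refine Finset.sum_congr rfl fun j _ => ?_
    rw [map_mul, mul_pow, ← map_pow τ b, ← map_pow τ b, pow_sub_field k b hb, mul_comm]
  have hcard' : Fintype.card E = 2 ^ (2 * (3 * k)) := by rw [hcard, hm]
  have hA0 := linpoly_zero k (by omega) hcard' (fun i => π (A i)) (by
    intro b hb
    obtain ⟨w, hw⟩ := hA b hb
    have := congrArg π hw
    simp only [map_sum, map_mul, map_pow, hτ] at this
    rw [this]
    have : (4 : W) = 2 * 2 := by norm_num
    rw [this, map_mul, hπ2]; simp)
  have hB : ∀ i, ∃ v, i < k → A i = 2 * v := by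
    intro i
    by_cases hi : i < k
    · obtain ⟨v, hv⟩ := hπ _ (hA0 i hi)
      exact ⟨v, fun _ => hv⟩
    · exact ⟨0, fun h => absurd h hi⟩
  choose B hB using hB
  have hB0 := linpoly_zero k (by omega) hcard' (fun i => π (B i)) (by
    intro b hb
    obtain ⟨w, hw⟩ := hA b hb
    have h3 : ∑ i ∈ Finset.range k, τ b ^ (2 ^ i) * B i = 2 * w := by
      apply mul_left_cancel₀ h2
      rw [Finset.mul_sum]
      rw [Finset.sum_congr rfl fun i hi => show _ = τ b ^ (2 ^ i) * A i by
        rw [hB i (Finset.mem_range.mp hi)]; ring]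
      rw [hw]; ring
    have := congrArg π h3
    simp only [map_sum, map_mul, map_pow, hτ] at this
    rw [this, hπ2, zero_mul])
  obtain ⟨v1, hv1⟩ := hπ _ (hB0 1 (by omega))
  have hA1 := hB 1 (by omega)
  have hAz := hB 0 (by omega)
  have e1 := hA0 0 (by omega)
  simp only [A, Finset.sum_range_succ, Finset.sum_range_zero, mul_zero, zero_add, add_zero, mul_one,
    pow_zero, pow_one] at hA1 hAz e1
  set x := τ a
  set y := τ a ^ 2 ^ k with hy
  set z := τ a ^ 2 ^ (k * 2) with hz
  have hy2 : τ a ^ 2 ^ (k + 1) = y ^ 2 := by rw [hy, ← pow_mul, pow_succ]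
  have hz2 : τ a ^ 2 ^ (k * 2 + 1) = z ^ 2 := by rw [hz, ← pow_mul, pow_succ]
  rw [hy2, hz2] at hA1
  have he2 : x * y + y * z + z * x = 2 * (B 0 ^ 2 - v1) := by
    apply mul_left_cancel₀ h2
    have : (x + y + z) ^ 2 = (2 * B 0) ^ 2 := by rw [hAz]
    linear_combination this - hA1 - 2 * hv1
  have e2 := congrArg π he2
  simp only [map_add, map_mul, hπ2, zero_mul] at e2
  simp only [map_add] at e1
  have hx' : π x = a := hτ a
  have hy' : π y = a ^ 2 ^ k := by rw [hy, map_pow, hτ]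
  rw [hx', hy'] at e1 e2
  set a' := a ^ 2 ^ k with ha'
  set a'' := π z
  have h3 : a' ^ 3 = a ^ 3 := by
    have h4 : a ^ 3 - a' ^ 3 = 0 := by
      linear_combination (a - a') * (a + a') * e1 - (a - a') * e2
    exact (sub_eq_zero.mp h4).symm
  have h5 : a ^ (3 * (2 ^ k - 1)) * a ^ 3 = 1 * a ^ 3 := by
    rw [one_mul, ← pow_add, ← h3, ha', ← pow_mul]
    congr 1
    have : 1 ≤ 2 ^ k := Nat.one_le_two_pow
    omega
  exact mul_right_cancel₀ (pow_ne_zero 3 ha) h5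

end Helpers

/-- For even `k > 0`, `m = 3k` and a nonzero `a` in the subfield
`F_{2^m} = {a : E | a^(2^m) = a}` of `E = F_{2^{2m}}`, if the function
`f(x) = Tr^{2m}_k(a x^(2^m - 1))` from `E` to `F_{2^k} ⊆ E` is bent,
then `a^(3(2^k - 1)) = 1`. -/
theorem stmt3 {E : Type*} [Field E] [Fintype E] [DecidableEq E] (k m : ℕ)
    (heven : Even k) (hk : 0 < k) (hm : m = 3 * k)
    (hcard : Fintype.card E = 2 ^ (2 * m)) (a : E) (haF : a ^ (2 ^ m) = a) (ha : a ≠ 0)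
    (hbent : IsBent (2 * m) k (fun x => relTrace k (2 * m) (a * x ^ (2 ^ m - 1)))) :
    a ^ (3 * (2 ^ k - 1)) = 1 := by
  classical
  have hk2 : 2 ≤ k := by
    obtain ⟨r, hr⟩ := heven
    omega
  haveI : Fact (Nat.Prime 2) := ⟨Nat.prime_two⟩
  haveI : CharP E 2 := charP_of_card_eq_prime_pow hcard
  have h2 : (2 : WittVector 2 E) ≠ 0 := by
    have := WittVector.p_nonzero 2 E
    exact_mod_cast this
  refine final_step (W := WittVector 2 E) k m hk2 hm hcard a haF ha (WittVector.teichmuller 2)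
    WittVector.constantCoeff (fun x => WittVector.teichmuller_coeff_zero 2 x) ?_ h2 hbent
  intro w hw
  have hw' : w ∈ RingHom.ker (WittVector.constantCoeff : WittVector 2 E →+* E) := hw
  rw [WittVector.ker_constantCoeff, Ideal.mem_span_singleton] at hw'
  exact_mod_cast hw'
end

section
/- Let a be an element of F_{2^6} satisfying a^6 + a^3 + 1 = 0 (i.e., a is a primitive 9-th root of unity in F_{2^6}). Then the function f : F_{2^{12}} → F_{2^2} given by f(x) = Tr^{12}_2(a x^{2^6 - 1}) is bent. -/
theorem rr {E : Type*} [Field E] (z : E) (h2 : (2:E) = 0) (hz : 1+z+z^2+z^3+z^4+z^5+z^6+z^7+z^8+z^9+z^10+z^11+z^12 = 0) : (z^0 + z^3 + z^5 + z^8 + z^10)^6 + (z^0 + z^3 + z^5 + z^8 + z^10)^3 + 1 = 0 := by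
  have h1 : (z^0 + z^3 + z^5 + z^8 + z^10)*(z^0 + z^3 + z^5 + z^8 + z^10) = (z^0 + z^3 + z^6 + z^7 + z^10) := by
    linear_combination (z^3 + z^4 + z^7 + z^8) * hz + ((-1)*z^4 + (-1)*z^6 + (-2)*z^7 + (-2)*z^9 + (-1)*z^10 + (-1)*z^11 + (-2)*z^12 + (-2)*z^14 + (-1)*z^15 + (-1)*z^16 + (-1)*z^17 + (-1)*z^19) * h2
  have h3 : (z^0 + z^3 + z^6 + z^7 + z^10)*(z^0 + z^3 + z^5 + z^8 + z^10) = (z^2 + z^5 + z^6 + z^7 + z^8 + z^11) := by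
    linear_combination (z^0 + z^1 + z^2 + z^3 + z^6 + z^7 + z^8) * hz + ((-1)*z^1 + (-2)*z^2 + (-1)*z^3 + (-2)*z^4 + (-2)*z^5 + (-2)*z^6 + (-3)*z^7 + (-3)*z^8 + (-3)*z^9 + (-2)*z^10 + (-3)*z^11 + (-3)*z^12 + (-2)*z^13 + (-2)*z^14 + (-1)*z^15 + (-1)*z^16 + (-1)*z^17 + (-1)*z^18 + (-1)*z^19) * h2
  have h4 : (z^2 + z^5 + z^6 + z^7 + z^8 + z^11)*(z^2 + z^5 + z^6 + z^7 + z^8 + z^11) + (z^2 + z^5 + z^6 + z^7 + z^8 + z^11) + 1 = 0 := by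
    linear_combination (z^0 + z^1 + z^2 + z^3 + z^4 + z^9 + z^10) * hz + ((-1)*z^1 + (-1)*z^2 + (-2)*z^3 + (-2)*z^4 + (-2)*z^5 + (-2)*z^6 + (-1)*z^7 + (-1)*z^8 + (-2)*z^9 + (-2)*z^10 + (-2)*z^11 + (-2)*z^12 + (-1)*z^14 + (-1)*z^15 + (-1)*z^20 + (-1)*z^21) * h2
  generalize (z^0 + z^3 + z^5 + z^8 + z^10) = r at *
  generalize (z^0 + z^3 + z^6 + z^7 + z^10) = A at *
  generalize (z^2 + z^5 + z^6 + z^7 + z^8 + z^11) = s at *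
  subst h1
  subst h3
  linear_combination h4
theorem ee {E : Type*} [Field E] (z : E) (h2 : (2:E) = 0) (hz : 1+z+z^2+z^3+z^4+z^5+z^6+z^7+z^8+z^9+z^10+z^11+z^12 = 0) : 1 + (z^0 + z^1 + z^3 + z^9) + (z^0 + z^1 + z^3 + z^9)^2 + (z^0 + z^1 + z^3 + z^9)^3 + (z^0 + z^1 + z^3 + z^9)^4 = 0 := by
  have h1 : (z^0 + z^1 + z^3 + z^9)*(z^0 + z^1 + z^3 + z^9) = (z^0 + z^2 + z^5 + z^6) := by
    linear_combination (z^5 + z^6) * hz + (z^1 + z^3 + z^4 + (-1)*z^5 + (-1)*z^6 + (-1)*z^7 + (-1)*z^8 + (-1)*z^11 + (-1)*z^13 + (-1)*z^14 + (-1)*z^15 + (-1)*z^16 + (-1)*z^17) * h2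
  have h3 : (z^0 + z^2 + z^5 + z^6)*(z^0 + z^1 + z^3 + z^9) = (z^0 + z^7 + z^8 + z^11) := by
    linear_combination (z^1 + z^3) * hz + ((-1)*z^4 + (-1)*z^7 + (-1)*z^8 + (-1)*z^10 + (-1)*z^11 + (-1)*z^12 + (-1)*z^13) * h2
  have h4 : (z^0 + z^7 + z^8 + z^11)*(z^0 + z^1 + z^3 + z^9) = (z^1 + z^2 + z^3 + z^5 + z^6 + z^7 + z^8 + z^9 + z^11) := by
    linear_combination (z^0 + z^1 + z^2 + z^3 + z^5 + z^7 + z^8) * hz + ((-1)*z^1 + (-2)*z^2 + (-2)*z^3 + (-2)*z^4 + (-3)*z^5 + (-3)*z^6 + (-3)*z^7 + (-3)*z^8 + (-3)*z^9 + (-3)*z^10 + (-3)*z^11 + (-3)*z^12 + (-3)*z^13 + (-2)*z^14 + (-2)*z^15 + (-1)*z^16 + (-1)*z^17 + (-1)*z^18 + (-1)*z^19) * h2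
  have h5 : 1 + (z^0 + z^1 + z^3 + z^9) + (z^0 + z^2 + z^5 + z^6) + (z^0 + z^7 + z^8 + z^11) + (z^1 + z^2 + z^3 + z^5 + z^6 + z^7 + z^8 + z^9 + z^11) = 0 := by
    linear_combination (0) * hz + ((2)*z^0 + z^1 + z^2 + z^3 + z^5 + z^6 + z^7 + z^8 + z^9 + z^11) * h2
  rw [← h4, ← h3, ← h1] at h5
  linear_combination h5
theorem ss0 {E : Type*} [Field E] (z : E) (h2 : (2:E) = 0) (hz : 1+z+z^2+z^3+z^4+z^5+z^6+z^7+z^8+z^9+z^10+z^11+z^12 = 0) : (z^0 + z^3 + z^5 + z^8 + z^10) * (z^0 + z^1 + z^3 + z^9) = (z^0 + z^1 + z^2 + z^3 + z^4 + z^7 + z^8 + z^9 + z^11) := by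
  linear_combination (z^2 + z^4 + z^5 + z^6 + z^7) * hz + ((-1)*z^2 + (-1)*z^4 + (-1)*z^5 + (-1)*z^6 + (-3)*z^7 + (-2)*z^8 + (-2)*z^9 + (-2)*z^10 + (-2)*z^11 + (-2)*z^12 + (-2)*z^13 + (-2)*z^14 + (-2)*z^15 + (-2)*z^16 + (-1)*z^17 + (-1)*z^18) * h2
theorem ss1 {E : Type*} [Field E] (z : E) (h2 : (2:E) = 0) (hz : 1+z+z^2+z^3+z^4+z^5+z^6+z^7+z^8+z^9+z^10+z^11+z^12 = 0) : (z^0 + z^1 + z^2 + z^3 + z^4 + z^7 + z^8 + z^9 + z^11) * (z^0 + z^1 + z^3 + z^9) = (z^0 + z^2 + z^3 + z^4 + z^8) := by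
  linear_combination (z^2 + z^3 + z^6 + z^7 + z^8) * hz + (z^1 + (-1)*z^6 + (-1)*z^7 + (-2)*z^8 + (-1)*z^9 + (-1)*z^10 + (-1)*z^11 + (-1)*z^12 + (-2)*z^13 + (-2)*z^14 + (-2)*z^15 + (-1)*z^16 + (-1)*z^17 + (-1)*z^18 + (-1)*z^19) * h2
theorem ss2 {E : Type*} [Field E] (z : E) (h2 : (2:E) = 0) (hz : 1+z+z^2+z^3+z^4+z^5+z^6+z^7+z^8+z^9+z^10+z^11+z^12 = 0) : (z^0 + z^2 + z^3 + z^4 + z^8) * (z^0 + z^1 + z^3 + z^9) = (z^0 + z^5 + z^9 + z^10 + z^11) := by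
  linear_combination (z^1 + z^4 + z^5) * hz + (z^3 + (-1)*z^5 + (-1)*z^6 + (-1)*z^7 + (-1)*z^8 + (-1)*z^9 + (-2)*z^10 + (-1)*z^11 + (-1)*z^12 + (-1)*z^13 + (-1)*z^14 + (-1)*z^15 + (-1)*z^16) * h2
theorem ss3 {E : Type*} [Field E] (z : E) (h2 : (2:E) = 0) (hz : 1+z+z^2+z^3+z^4+z^5+z^6+z^7+z^8+z^9+z^10+z^11+z^12 = 0) : (z^0 + z^5 + z^9 + z^10 + z^11) * (z^0 + z^1 + z^3 + z^9) = (z^1 + z^3 + z^7 + z^8) := by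
  linear_combination (z^0 + z^1 + z^5 + z^8) * hz + ((-1)*z^1 + (-1)*z^2 + (-1)*z^3 + (-1)*z^4 + (-1)*z^5 + (-1)*z^6 + (-2)*z^7 + (-2)*z^8 + (-1)*z^9 + (-1)*z^10 + (-1)*z^11 + (-1)*z^12 + (-1)*z^13 + (-1)*z^15 + (-1)*z^16 + (-1)*z^17) * h2

section helpers

variable {E : Type*} [Field E]

theorem T_add [CharP E 2] (m : ℕ) (x y : E) :
    absTrace m (x + y) = absTrace m x + absTrace m y := by
  have : Fact (Nat.Prime 2) := ⟨Nat.prime_two⟩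
  simp only [absTrace, add_pow_char_pow, Finset.sum_add_distrib]

theorem T_zero (m : ℕ) : absTrace m (0 : E) = 0 := by
  simp [absTrace]

theorem T_sum [CharP E 2] (m : ℕ) {ι : Type*} (s : Finset ι) (f : ι → E) :
    absTrace m (∑ i ∈ s, f i) = ∑ i ∈ s, absTrace m (f i) := by
  classical
  induction s using Finset.induction_on with
  | empty => simp [T_zero]
  | insert a s ha ih => rw [Finset.sum_insert ha, Finset.sum_insert ha, T_add, ih]

theorem T_bit [CharP E 2] (hE : ∀ x : E, x ^ 4096 = x) (x : E) :
    absTrace 12 x = 0 ∨ absTrace 12 x = 1 := by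
  have : Fact (Nat.Prime 2) := ⟨Nat.prime_two⟩
  have h : (absTrace 12 x) ^ 2 = absTrace 12 x := by
    have h1 : (absTrace 12 x) ^ 2 = ∑ i ∈ Finset.range 12, x ^ (2 ^ (i + 1)) := by
      rw [absTrace, sum_pow_char]
      exact Finset.sum_congr rfl fun i _ => by rw [← pow_mul, pow_succ]
    have h12 : x ^ (2 ^ (11 + 1)) = x ^ (2 ^ 0) := by
      norm_num [hE]
    rw [h1, Finset.sum_range_succ, absTrace, h12, ← Finset.sum_range_succ' (fun i => x ^ (2 ^ i))]
  have h3 : absTrace 12 x * (absTrace 12 x - 1) = 0 := by linear_combination h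
  rcases mul_eq_zero.1 h3 with h | h
  · exact Or.inl h
  · exact Or.inr (sub_eq_zero.1 h)

theorem two_zero [CharP E 2] : (2 : E) = 0 := CharP.cast_eq_zero E 2

theorem chi_add [DecidableEq E] [CharP E 2] (hE : ∀ x : E, x ^ 4096 = x) (x y : E) :
    sgn (absTrace 12 (x + y)) = sgn (absTrace 12 x) * sgn (absTrace 12 y) := by
  have h2 : (1 + 1 : E) = 0 := by rw [one_add_one_eq_two]; exact two_zero
  rw [T_add]
  rcases T_bit hE x with h | h <;> rcases T_bit hE y with h' | h' <;>
    rw [h, h'] <;> simp [sgn, h2]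

/-- The trace of elements of the subfield of order `64` vanishes. -/
theorem T_K [CharP E 2] (x : E) (hx : x ^ 64 = x) : absTrace 12 x = 0 := by
  have e (k : ℕ) : x ^ (64 * k) = x ^ k := by rw [pow_mul, hx]
  have e1 := e 2
  have e2 := e 4
  have e3 := e 8
  have e4 := e 16
  have e5 := e 32
  norm_num at e1 e2 e3 e4 e5
  simp only [absTrace, Finset.sum_range_succ, Finset.sum_range_zero]
  norm_num
  rw [hx, e1, e2, e3, e4, e5]
  linear_combination (x + x ^ 2 + x ^ 4 + x ^ 8 + x ^ 16 + x ^ 32) * two_zero (E := E)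

theorem T_six [CharP E 2] (x : E) : absTrace 12 x = absTrace 6 (x + x ^ 64) := by
  rw [T_add]
  simp only [absTrace, Finset.sum_range_succ, Finset.sum_range_zero, ← pow_mul]
  norm_num
  ring

theorem T_rel [CharP E 2] (b y : E) (hb : b ^ 4 = b) :
    absTrace 2 (b * relTrace 2 12 y) = absTrace 12 (b * y) := by
  have : Fact (Nat.Prime 2) := ⟨Nat.prime_two⟩
  have e (k : ℕ) : b ^ (4 * k) = b ^ k := by rw [pow_mul, hb]
  have e1 := e 2
  have e2 := e 4
  have e3 := e 8
  have e4 := e 16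
  have e5 := e 32
  have e6 := e 64
  have e7 := e 128
  have e8 := e 256
  have e9 := e 512
  norm_num at e1 e2 e3 e4 e5 e6 e7 e8 e9
  have hsq : (relTrace 2 12 y) ^ 2 = ∑ i ∈ Finset.range 6, y ^ (2 ^ (2 * i + 1)) := by
    rw [relTrace, sum_pow_char]
    exact Finset.sum_congr rfl fun i _ => by rw [← pow_mul, pow_succ]
  have h0 : absTrace 2 (b * relTrace 2 12 y)
      = b * relTrace 2 12 y + b ^ 2 * (relTrace 2 12 y) ^ 2 := by
    simp [absTrace, Finset.sum_range_succ, mul_pow]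
  rw [h0, hsq]
  simp only [absTrace, relTrace, Finset.sum_range_succ, Finset.sum_range_zero, mul_pow]
  norm_num [Finset.sum_range_succ]
  rw [e9, e8, e7, e6, e5, e4, e3, e2, e1, hb]
  ring

theorem phi_of [CharP E 2] (z : E) (hz : z ^ 13 = 1) (h1 : z ≠ 1) :
    1+z+z^2+z^3+z^4+z^5+z^6+z^7+z^8+z^9+z^10+z^11+z^12 = 0 := by
  have : (z - 1) * (1+z+z^2+z^3+z^4+z^5+z^6+z^7+z^8+z^9+z^10+z^11+z^12) = 0 := by
    linear_combination hz
  exact (mul_eq_zero.1 this).resolve_left (sub_ne_zero.2 h1)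

theorem T_root [CharP E 2] (w : E) (hw : w ^ 13 = 1) (h1 : w ≠ 1) : absTrace 12 w = 1 := by
  have hp := phi_of w hw h1
  have e (k : ℕ) : w ^ k = w ^ (k % 13) := by
    conv_lhs => rw [← Nat.mod_add_div k 13, pow_add, pow_mul, hw, one_pow, mul_one]
  have e4 := e 16
  have e5 := e 32
  have e6 := e 64
  have e7 := e 128
  have e8 := e 256
  have e9 := e 512
  have e10 := e 1024
  have e11 := e 2048
  norm_num at e4 e5 e6 e7 e8 e9 e10 e11
  simp only [absTrace, Finset.sum_range_succ, Finset.sum_range_zero]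
  norm_num
  rw [e4, e5, e6, e7, e8, e9, e10, e11]
  linear_combination hp - two_zero (E := E)

theorem T_one [CharP E 2] : absTrace 12 (1 : E) = 0 := T_K 1 (one_pow _)

theorem T_zpow [CharP E 2] (z : E) (hz : z ^ 13 = 1) (h1 : z ≠ 1) (n : ℕ) :
    absTrace 12 (z ^ n) = if 13 ∣ n then 0 else 1 := by
  have : Fact (Nat.Prime 13) := ⟨by norm_num⟩
  have ho : orderOf z = 13 := orderOf_eq_prime hz h1
  split_ifs with h
  · obtain ⟨k, rfl⟩ := h
    rw [pow_mul, hz, one_pow, T_one]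
  · apply T_root
    · rw [← pow_mul, mul_comm, pow_mul, hz, one_pow]
    · intro h'
      exact h (ho ▸ orderOf_dvd_of_pow_eq_one h')

/-- The supports of the expansions of `c * e ^ i` in powers of `z`. -/
def SF : ℕ → Finset ℕ
  | 0 => {0, 3, 5, 8, 10}
  | 1 => {0, 1, 2, 3, 4, 7, 8, 9, 11}
  | 2 => {0, 2, 3, 4, 8}
  | 3 => {0, 5, 9, 10, 11}
  | _ => {1, 3, 7, 8}

theorem chi_sum_aux [DecidableEq E] [CharP E 2] (z : E) (hz : z ^ 13 = 1) (h1 : z ≠ 1)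
    (S : Finset ℕ) (n : ℕ) :
    sgn (absTrace 12 ((∑ m ∈ S, z ^ m) * z ^ n)) =
      if (S.filter (fun m => ¬ 13 ∣ m + n)).card % 2 = 0 then 1 else -1 := by
  have h : absTrace 12 ((∑ m ∈ S, z ^ m) * z ^ n)
      = (((S.filter (fun m => ¬ 13 ∣ m + n)).card : ℕ) : E) := by
    rw [Finset.sum_mul, T_sum, Finset.card_filter, Nat.cast_sum]
    refine Finset.sum_congr rfl fun m _ => ?_
    rw [← pow_add, T_zpow z hz h1]
    split_ifs <;> simp
  rw [h, sgn]
  congr 1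
  rw [CharP.cast_eq_zero_iff E 2]
  exact propext (Nat.dvd_iff_mod_eq_zero)

theorem count_eq : ∑ n ∈ Finset.range 65,
    (if ((SF (n % 5)).filter (fun m => ¬ 13 ∣ m + n)).card % 2 = 0 then (1 : ℤ) else -1) = 1 := by
  decide +kernel

/-- The root-of-unity sum, for `c` expressed in `z`. -/
theorem sum_U [Fintype E] [DecidableEq E] [CharP E 2] (z c : E) (hz : z ^ 13 = 1) (h1 : z ≠ 1)
    (hc : c = z^0 + z^3 + z^5 + z^8 + z^10) :
    ∑ u ∈ Finset.univ.filter (fun u : E => u ^ 65 = 1), sgn (absTrace 12 (c * u)) = 1 ∧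
      (Finset.univ.filter (fun u : E => u ^ 65 = 1)).card = 65 := by
  have hp := phi_of z hz h1
  have h2 := two_zero (E := E)
  have hee := ee z h2 hp
  have s0 := ss0 z h2 hp
  have s1 := ss1 z h2 hp
  have s2 := ss2 z h2 hp
  have s3 := ss3 z h2 hp
  rw [← hc] at s0
  generalize (z^0 + z^1 + z^3 + z^9) = e at *
  have he5 : e ^ 5 = 1 := by linear_combination (e - 1) * hee
  have he1 : e ≠ 1 := by
    rintro rfl
    have : (1 : E) = 0 := by linear_combination hee - 2 * h2
    exact one_ne_zero this
  have : Fact (Nat.Prime 13) := ⟨by norm_num⟩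
  have : Fact (Nat.Prime 5) := ⟨by norm_num⟩
  have ho : orderOf z = 13 := orderOf_eq_prime hz h1
  have ho' : orderOf e = 5 := orderOf_eq_prime he5 he1
  have hv : orderOf (e * z) = 65 := by
    rw [(Commute.all e z).orderOf_mul_eq_mul_orderOf_of_coprime (by rw [ho, ho']; norm_num),
      ho, ho']
  have hprim : IsPrimitiveRoot (e * z) 65 := hv ▸ IsPrimitiveRoot.orderOf (e * z)
  have hU : Finset.univ.filter (fun u : E => u ^ 65 = 1)
      = (Finset.range 65).image (fun n => (e * z) ^ n) := by
    ext u
    simp only [Finset.mem_filter, Finset.mem_univ, true_and, Finset.mem_image, Finset.mem_range]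
    constructor
    · intro h
      obtain ⟨i, hi, h⟩ := hprim.eq_pow_of_pow_eq_one h
      exact ⟨i, hi, h⟩
    · rintro ⟨i, _, rfl⟩
      rw [← pow_mul, mul_comm i, pow_mul, hprim.pow_eq_one, one_pow]
  have hinj : Set.InjOn (fun n => (e * z) ^ n) (Finset.range 65 : Set ℕ) := by
    intro i hi j hj h
    exact hprim.pow_inj (by simpa using hi) (by simpa using hj) h
  refine ⟨?_, by rw [hU, Finset.card_image_of_injOn hinj, Finset.card_range]⟩
  rw [hU, Finset.sum_image hinj, ← count_eq]
  refine Finset.sum_congr rfl fun n _ => ?_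
  rw [← chi_sum_aux z hz h1]
  congr 2
  rw [mul_pow, ← mul_assoc]
  congr 1
  have en : e ^ n = e ^ (n % 5) := by
    conv_lhs => rw [← Nat.mod_add_div n 5, pow_add, pow_mul, he5, one_pow, mul_one]
  rw [en]
  have h5 : n % 5 < 5 := Nat.mod_lt _ (by norm_num)
  interval_cases n % 5
  · rw [hc]; simp [SF]; ring
  · rw [pow_one, s0]; simp [SF]; ring
  · rw [pow_two, ← mul_assoc, s0, s1]; simp [SF]; ring
  · rw [pow_succ, pow_two, ← mul_assoc, ← mul_assoc, s0, s1, s2]; simp [SF]; ring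
  · rw [pow_succ, pow_succ, pow_two, ← mul_assoc, ← mul_assoc, ← mul_assoc, s0, s1, s2, s3]
    simp [SF]; ring

theorem exists_z [Fintype E] [DecidableEq E] [CharP E 2] (hcard : Fintype.card E = 2 ^ 12)
    (c : E) (hc : c ^ 6 + c ^ 3 + 1 = 0) :
    ∃ z : E, z ^ 13 = 1 ∧ z ≠ 1 ∧ c = z^0 + z^3 + z^5 + z^8 + z^10 := by
  have : Fact (Nat.Prime 2) := ⟨Nat.prime_two⟩
  have : Fact (Nat.Prime 13) := ⟨by norm_num⟩
  have h2 := two_zero (E := E)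
  obtain ⟨g, hg⟩ := exists_prime_orderOf_dvd_card (G := Eˣ) 13
    (by rw [Fintype.card_units, hcard]; norm_num)
  have hz0 : orderOf (g : E) = 13 := by rw [orderOf_units, hg]
  have hz : (g : E) ^ 13 = 1 := hz0 ▸ pow_orderOf_eq_one (g : E)
  have key (j : ℕ) : ((g : E) ^ (2 ^ j)) ^ 13 = 1 ∧ (g : E) ^ (2 ^ j) ≠ 1 := by
    constructor
    · rw [← pow_mul, mul_comm, pow_mul, hz, one_pow]
    · intro h
      have := orderOf_dvd_of_pow_eq_one h
      rw [hz0] at this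
      have := (Nat.Prime.dvd_of_dvd_pow (by norm_num) this)
      norm_num at this
  have hr := rr (g : E) h2 (phi_of _ hz (by simpa using (key 0).2))
  generalize (g : E) = z at *
  have key2 (j : ℕ) : (z^0 + z^3 + z^5 + z^8 + z^10) ^ (2 ^ j) =
      (z^2^j)^0 + (z^2^j)^3 + (z^2^j)^5 + (z^2^j)^8 + (z^2^j)^10 := by
    simp only [add_pow_char_pow, ← pow_mul, mul_comm]
  have fin (j : ℕ) (h : c = (z^0 + z^3 + z^5 + z^8 + z^10) ^ (2 ^ j)) :
      ∃ z : E, z ^ 13 = 1 ∧ z ≠ 1 ∧ c = z^0 + z^3 + z^5 + z^8 + z^10 :=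
    ⟨z ^ 2 ^ j, (key j).1, (key j).2, by rw [h, key2]⟩
  generalize (z^0 + z^3 + z^5 + z^8 + z^10) = r at hr fin
  have r9 : r ^ 9 = 1 := by linear_combination (r ^ 3 - 1) * hr
  have hfac : (c - r) * (c - r^2) * (c - r^4) * (c - r^8) * (c - r^7) * (c - r^5) = 0 := by
    have q1 : (c - r) * (c - r^4) * (c - r^7) = c ^ 3 - r ^ 3 := by
      linear_combination (-c^2*r + c * r^2) * hr + (c * r^2 - r^3) * r9
    have q2 : (c - r^2) * (c - r^8) * (c - r^5) = c ^ 3 - r ^ 6 := by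
      linear_combination (-c^2*r^2 + c * r^4 - r^9+ r^6) * hr + c * r^4 * r9
    have : (c^3 - r^3) * (c^3 - r^6) = 0 := by
      linear_combination hc - c^3 * hr + r9
    linear_combination this + (c - r^2) * (c - r^8) * (c - r^5) * q1 + (c^3 - r^3) * q2
  have e16 : r ^ 16 = r ^ 7 := by linear_combination r ^ 7 * r9
  have e32 : r ^ 32 = r ^ 5 := by linear_combination (r ^ 5 + r^14 + r^23) * r9
  rcases mul_eq_zero.1 hfac with h | h
  · rcases mul_eq_zero.1 h with h | h
    · rcases mul_eq_zero.1 h with h | h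
      · rcases mul_eq_zero.1 h with h | h
        · rcases mul_eq_zero.1 h with h | h
          · exact fin 0 (by simpa using sub_eq_zero.1 h)
          · exact fin 1 (by simpa using sub_eq_zero.1 h)
        · exact fin 2 (by simpa using sub_eq_zero.1 h)
      · exact fin 3 (by simpa using sub_eq_zero.1 h)
    · exact fin 4 (by norm_num; rw [e16]; exact sub_eq_zero.1 h)
  · exact fin 5 (by norm_num; rw [e32]; exact sub_eq_zero.1 h)

/-- Polar decomposition of sums over nonzero elements. -/
theorem polar [Fintype E] [DecidableEq E] (hE : ∀ x : E, x ^ 4096 = x) (F : E → ℤ) :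
    ∑ x : E, F x = F 0 + ∑ u ∈ Finset.univ.filter (fun u : E => u ^ 65 = 1),
      ∑ y ∈ Finset.univ.filter (fun y : E => y ^ 63 = 1), F (y * u) := by
  rw [← Finset.add_sum_erase _ _ (Finset.mem_univ (0 : E)), ← Finset.sum_product']
  congr 1
  symm
  have h1 (x : E) (hx : x ≠ 0) : x ^ 4095 = 1 := by
    have := hE x
    have h' : x * (x ^ 4095 - 1) = 0 := by linear_combination this
    exact sub_eq_zero.1 ((mul_eq_zero.1 h').resolve_left hx)
  refine Finset.sum_bij' (fun p _ => p.2 * p.1) (fun x _ => (x ^ 2016, x ^ 2080)) ?_ ?_ ?_ ?_ ?_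
  · rintro ⟨u, y⟩ h
    simp only [Finset.mem_product, Finset.mem_filter, Finset.mem_univ, true_and] at h
    simp only [Finset.mem_erase, Finset.mem_univ, and_true]
    apply mul_ne_zero
    · rintro rfl; simp at h
    · rintro rfl; simp at h
  · intro x hx
    simp only [Finset.mem_erase, Finset.mem_univ, and_true] at hx
    simp only [Finset.mem_product, Finset.mem_filter, Finset.mem_univ, true_and]
    constructor
    · rw [← pow_mul, show 2016 * 65 = 4095 * 32 by norm_num, pow_mul, h1 x hx, one_pow]
    · rw [← pow_mul, show 2080 * 63 = 4095 * 32 by norm_num, pow_mul, h1 x hx, one_pow]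
  · rintro ⟨u, y⟩ h
    simp only [Finset.mem_product, Finset.mem_filter, Finset.mem_univ, true_and] at h
    obtain ⟨hu, hy⟩ := h
    ext
    · show (y * u) ^ 2016 = u
      rw [mul_pow, show 2016 = 63 * 32 by norm_num, pow_mul, hy, one_pow, one_mul,
        show 63 * 32 = 65 * 31 + 1 by norm_num, pow_succ, pow_mul, hu, one_pow, one_mul]
    · show (y * u) ^ 2080 = y
      rw [mul_pow, show 2080 = 65 * 32 by norm_num, pow_mul u, hu, one_pow, mul_one,
        show 65 * 32 = 63 * 33 + 1 by norm_num, pow_succ, pow_mul, hy, one_pow, one_mul]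
  · intro x hx
    show x ^ 2080 * x ^ 2016 = x
    rw [← pow_add]
    exact hE x
  · rintro ⟨u, y⟩ _
    rfl

/-- Character sum over the nonzero elements of the subfield of order `64`. -/
theorem sum_K [Fintype E] [DecidableEq E] [CharP E 2] (hE : ∀ x : E, x ^ 4096 = x)
    (hK : (Finset.univ.filter (fun y : E => y ^ 63 = 1)).card = 63)
    (c : E) (hc : c ^ 6 + c ^ 3 + 1 = 0) (t : E) :
    ∑ y ∈ Finset.univ.filter (fun y : E => y ^ 63 = 1), sgn (absTrace 12 (t * y)) =
      (if t ^ 64 = t then 64 else 0) - 1 := by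
  have : Fact (Nat.Prime 2) := ⟨Nat.prime_two⟩
  have h2 := two_zero (E := E)
  split_ifs with ht
  · have : ∀ y ∈ Finset.univ.filter (fun y : E => y ^ 63 = 1), sgn (absTrace 12 (t * y)) = 1 := by
      intro y hy
      simp only [Finset.mem_filter, Finset.mem_univ, true_and] at hy
      rw [T_K]
      · simp [sgn]
      · rw [mul_pow, ht, pow_succ y, hy, one_mul]
    rw [Finset.sum_congr rfl this]
    simp [hK]
  · have hset : Finset.univ.filter (fun y : E => y ^ 64 = y)
        = insert 0 (Finset.univ.filter (fun y : E => y ^ 63 = 1)) := by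
      ext y
      simp only [Finset.mem_filter, Finset.mem_univ, true_and, Finset.mem_insert]
      constructor
      · intro h
        have : y * (y ^ 63 - 1) = 0 := by linear_combination h
        rcases mul_eq_zero.1 this with h | h
        · exact Or.inl h
        · exact Or.inr (sub_eq_zero.1 h)
      · rintro (rfl | h)
        · simp
        · rw [pow_succ, h, one_mul]
    have hsum : ∑ y ∈ Finset.univ.filter (fun y : E => y ^ 64 = y), sgn (absTrace 12 (t * y))
        = 1 + ∑ y ∈ Finset.univ.filter (fun y : E => y ^ 63 = 1), sgn (absTrace 12 (t * y)) := by
      rw [hset, Finset.sum_insert (by simp)]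
      simp [T_zero, sgn]
    have c9 : c ^ 9 = 1 := by linear_combination (c ^ 3 - 1) * hc
    set s := t + t ^ 64 with hs
    have hs0 : s ≠ 0 := by
      intro h
      exact ht (by linear_combination h - t * h2)
    have hs64 : s ^ 64 = s := by
      have : (t + t ^ 64) ^ (2 ^ 6) = t ^ (2 ^ 6) + (t ^ 64) ^ (2 ^ 6) := add_pow_char_pow ..
      rw [hs]
      norm_num at this
      rw [this, ← pow_mul, hE t, add_comm]
    have hy64 : (c ^ 3 / s) ^ 64 = c ^ 3 / s := by
      rw [div_pow, hs64, ← pow_mul, show 3 * 64 = 9 * 21 + 3 by norm_num, pow_add, pow_mul, c9,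
        one_pow, one_mul]
    set y0 := c ^ 3 / s with hy0
    have hT : absTrace 12 (t * y0) = 1 := by
      rw [T_six, mul_pow, hy64, ← add_mul, ← hs, hy0, mul_div_cancel₀ _ hs0]
      have e (k : ℕ) : c ^ k = c ^ (k % 9) := by
        conv_lhs => rw [← Nat.mod_add_div k 9, pow_add, pow_mul, c9, one_pow, mul_one]
      simp only [absTrace, Finset.sum_range_succ, Finset.sum_range_zero, ← pow_mul]
      norm_num
      rw [e 12, e 24, e 48, e 96]
      norm_num
      linear_combination 3 * hc - 2 * h2
    have hshift : ∑ y ∈ Finset.univ.filter (fun y : E => y ^ 64 = y), sgn (absTrace 12 (t * y))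
        = ∑ y ∈ Finset.univ.filter (fun y : E => y ^ 64 = y), - sgn (absTrace 12 (t * y)) := by
      have hmem : ∀ y : E, y ^ 64 = y → (y + y0) ^ 64 = y + y0 := by
        intro y hy
        have : (y + y0) ^ (2 ^ 6) = y ^ (2 ^ 6) + y0 ^ (2 ^ 6) := add_pow_char_pow ..
        norm_num at this
        rw [this, hy, hy64]
      refine Finset.sum_bij' (fun y _ => y + y0) (fun y _ => y + y0) ?_ ?_ ?_ ?_ ?_
      · intro y hy
        simp only [Finset.mem_filter, Finset.mem_univ, true_and] at hy ⊢
        exact hmem y hy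
      · intro y hy
        simp only [Finset.mem_filter, Finset.mem_univ, true_and] at hy ⊢
        exact hmem y hy
      · intro y _
        linear_combination y0 * h2
      · intro y _
        linear_combination y0 * h2
      · intro y _
        rw [mul_add, chi_add hE, hT]
        simp [sgn]
    rw [Finset.sum_neg_distrib] at hshift
    linarith

theorem walsh_main [Fintype E] [DecidableEq E] [CharP E 2] (hcard : Fintype.card E = 2 ^ 12)
    (c : E) (hc : c ^ 6 + c ^ 3 + 1 = 0) (A : E) :
    (∑ x : E, sgn (absTrace 12 (c * x ^ 63) + absTrace 12 (A * x))).natAbs = 64 := by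
  have hE : ∀ x : E, x ^ 4096 = x := by
    intro x
    have := FiniteField.pow_card x
    rw [hcard] at this
    exact this
  obtain ⟨z, hz, hz1, hcz⟩ := exists_z hcard c hc
  obtain ⟨hS, hU⟩ := sum_U z c hz hz1 hcz
  have hK : (Finset.univ.filter (fun y : E => y ^ 63 = 1)).card = 63 := by
    have := polar hE (fun _ => 1)
    simp [hcard, hU] at this
    omega
  -- reindexing by the 63rd power
  have hS' : ∑ u ∈ Finset.univ.filter (fun u : E => u ^ 65 = 1),
      sgn (absTrace 12 (c * u ^ 63)) = 1 := by
    rw [← hS]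
    refine Finset.sum_bij' (fun u _ => u ^ 63) (fun u _ => u ^ 32) ?_ ?_ ?_ ?_ ?_
    · intro u hu
      simp only [Finset.mem_filter, Finset.mem_univ, true_and] at hu ⊢
      rw [← pow_mul, mul_comm, pow_mul, hu, one_pow]
    · intro u hu
      simp only [Finset.mem_filter, Finset.mem_univ, true_and] at hu ⊢
      rw [← pow_mul, mul_comm, pow_mul, hu, one_pow]
    · intro u hu
      simp only [Finset.mem_filter, Finset.mem_univ, true_and] at hu
      rw [← pow_mul, show 63 * 32 = 65 * 31 + 1 by norm_num, pow_succ, pow_mul, hu, one_pow,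
        one_mul]
    · intro u hu
      simp only [Finset.mem_filter, Finset.mem_univ, true_and] at hu
      rw [← pow_mul, show 32 * 63 = 65 * 31 + 1 by norm_num, pow_succ, pow_mul, hu, one_pow,
        one_mul]
    · intro u _
      rfl
  have hW : ∑ x : E, sgn (absTrace 12 (c * x ^ 63) + absTrace 12 (A * x)) =
      64 * ∑ u ∈ Finset.univ.filter (fun u : E => u ^ 65 = 1),
        (if (A * u) ^ 64 = A * u then sgn (absTrace 12 (c * u ^ 63)) else 0) := by
    rw [polar hE]
    have hin : ∀ u ∈ Finset.univ.filter (fun u : E => u ^ 65 = 1),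
        ∑ y ∈ Finset.univ.filter (fun y : E => y ^ 63 = 1),
          sgn (absTrace 12 (c * (y * u) ^ 63) + absTrace 12 (A * (y * u))) =
        64 * (if (A * u) ^ 64 = A * u then sgn (absTrace 12 (c * u ^ 63)) else 0)
          - sgn (absTrace 12 (c * u ^ 63)) := by
      intro u _
      have : ∀ y ∈ Finset.univ.filter (fun y : E => y ^ 63 = 1),
          sgn (absTrace 12 (c * (y * u) ^ 63) + absTrace 12 (A * (y * u))) =
          sgn (absTrace 12 (c * u ^ 63)) * sgn (absTrace 12 ((A * u) * y)) := by
        intro y hy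
        simp only [Finset.mem_filter, Finset.mem_univ, true_and] at hy
        rw [← T_add, chi_add hE, mul_pow, hy, one_mul, mul_assoc A, mul_comm y]
      rw [Finset.sum_congr rfl this, ← Finset.mul_sum, sum_K hE hK c hc]
      split_ifs <;> ring
    rw [Finset.sum_congr rfl hin, Finset.sum_sub_distrib, hS', ← Finset.mul_sum]
    simp [T_zero, sgn]
  rw [hW]
  by_cases hA : A = 0
  · subst hA
    simp [hS']
  · have hA1 : A ^ 4095 = 1 := by
      have h' : A * (A ^ 4095 - 1) = 0 := by linear_combination hE A
      exact sub_eq_zero.1 ((mul_eq_zero.1 h').resolve_left hA)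
    have h65 : (A ^ 2079) ^ 65 = 1 := by
      rw [← pow_mul, show 2079 * 65 = 4095 * 33 by norm_num, pow_mul, hA1, one_pow]
    rw [Finset.sum_eq_single (A ^ 2079)]
    · have : (A * A ^ 2079) ^ 64 = A * A ^ 2079 := by
        rw [← pow_succ', ← pow_mul, show (2079 + 1) * 64 = 4095 * 32 + (2079 + 1) by norm_num,
          pow_add, pow_mul, hA1, one_pow, one_mul]
      rw [if_pos this, sgn]
      split_ifs <;> norm_num
    · intro u hu hne
      simp only [Finset.mem_filter, Finset.mem_univ, true_and] at hu
      rw [if_neg]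
      intro h
      apply hne
      have hu0 : u ≠ 0 := by
        rintro rfl
        simp at hu
      have h63 : (A * u) ^ 63 = 1 := by
        have h' : (A * u) * ((A * u) ^ 63 - 1) = 0 := by linear_combination h
        exact sub_eq_zero.1 ((mul_eq_zero.1 h').resolve_left (mul_ne_zero hA hu0))
      have h3 : (A * u) ^ (63 * 33) = 1 := by rw [pow_mul, h63, one_pow]
      have h4 : u ^ 2080 = 1 := by
        rw [show 2080 = 65 * 32 by norm_num, pow_mul, hu, one_pow]
      rw [mul_pow] at h3
      norm_num at h3
      calc u = (A ^ 2079 * u ^ 2079) * u := by rw [h3, one_mul]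
        _ = A ^ 2079 * u ^ 2080 := by rw [mul_assoc, ← pow_succ]
        _ = A ^ 2079 := by rw [h4, mul_one]
    · intro h
      exact absurd (by simpa using h65) (by simpa using h)

end helpers

/-- If `a` lies in the subfield `F_{2^6} = {a : E | a^(2^6) = a}` of `E = F_{2^{12}}`
and satisfies `a^6 + a^3 + 1 = 0`, then `f(x) = Tr^{12}_2(a x^(2^6 - 1))` from `E`
to `F_{2^2} ⊆ E` is bent. -/
theorem stmt12 {E : Type*} [Field E] [Fintype E] [DecidableEq E]
    (hcard : Fintype.card E = 2 ^ 12) (a : E) (haF : a ^ (2 ^ 6) = a)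
    (ha : a ^ 6 + a ^ 3 + 1 = 0) :
    IsBent 12 2 (fun x => relTrace 2 12 (a * x ^ (2 ^ 6 - 1))) := by
  have : Fact (Nat.Prime 2) := ⟨Nat.prime_two⟩
  have : CharP E 2 := charP_of_card_eq_prime_pow hcard
  intro A b hb hb0
  have hb4 : b ^ 4 = b := hb
  have hb3 : b ^ 3 = 1 := by
    have h' : b * (b ^ 3 - 1) = 0 := by linear_combination hb4
    exact sub_eq_zero.1 ((mul_eq_zero.1 h').resolve_left hb0)
  have hc : (b * a) ^ 6 + (b * a) ^ 3 + 1 = 0 := by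
    linear_combination ha + (a ^ 6 * (b ^ 3 + 1) + a ^ 3) * hb3
  have := walsh_main hcard (b * a) hc A
  rw [walsh]
  simp only [T_rel b _ hb4]
  simpa [mul_assoc] using this
end
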